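/- arXiv:2107.01710 — 7 statements merged into one kernel-verified Lean document; each statement's English description precedes it below -/
import Mathlib

section
/- Let G be a connected, leafless, non–self-embeddable graph and let H be a finite star forest. Then there exists an (S(G),H)-minimal graph, i.e., a graph F with F → (S(G),H) such that no proper subgraph F' of F satisfies F' → (S(G),H). -/
open SimpleGraph

universe u v w x

/-- A monochromatic copy: `col = true` means red, `col = false` means blue.
There is a copy of `G` in `F` all of whose edges get color `col` under `c`. -/
def HasMonoCopy {α β : Type*} (F : SimpleGraph α) (c : Sym2 α → Bool) (col : Bool)
    (G : SimpleGraph β) : Prop :=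
  ∃ f : β → α, Function.Injective f ∧
    ∀ ⦃x y⦄, G.Adj x y → F.Adj (f x) (f y) ∧ c s(f x, f y) = col

/-- `F → (G,H)`: every red-blue edge coloring of `F` yields a red `G` or a blue `H`. -/
def Arrows {α β γ : Type*} (F : SimpleGraph α) (G : SimpleGraph β) (H : SimpleGraph γ) : Prop :=
  ∀ c : Sym2 α → Bool, HasMonoCopy F c true G ∨ HasMonoCopy F c false H

/-- A `(G,H)`-good coloring of `F`: neither a red copy of `G` nor a blue copy of `H`. -/
def GoodColoring {α β γ : Type*} (F : SimpleGraph α) (G : SimpleGraph β) (H : SimpleGraph γ)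
    (c : Sym2 α → Bool) : Prop :=
  ¬ HasMonoCopy F c true G ∧ ¬ HasMonoCopy F c false H

/-- `F` is `(G,H)`-minimal: `F → (G,H)` but no proper subgraph of `F` arrows `(G,H)`. -/
def IsRamseyMinimal {α β γ : Type*} (F : SimpleGraph α) (G : SimpleGraph β)
    (H : SimpleGraph γ) : Prop :=
  Arrows F G H ∧ ∀ F' : F.Subgraph, F' ≠ ⊤ → ¬ Arrows F'.coe G H

/-- `G` embeds into `H` (as a, not necessarily induced, subgraph). -/
def Embeds {α β : Type*} (G : SimpleGraph α) (H : SimpleGraph β) : Prop :=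
  ∃ f : α → β, Function.Injective f ∧ ∀ ⦃x y⦄, G.Adj x y → H.Adj (f x) (f y)

/-- `G` is self-embeddable: it is isomorphic to a proper subgraph of itself. -/
def SelfEmbeddable {α : Type*} (G : SimpleGraph α) : Prop :=
  ∃ G' : G.Subgraph, G' ≠ ⊤ ∧ Nonempty (G ≃g G'.coe)

/-- A graph is leafless if no vertex has exactly one neighbor. -/
def Leafless {α : Type*} (G : SimpleGraph α) : Prop :=
  ∀ v : α, ¬ ∃! w, G.Adj v w

/-- `G` is a star `K_{1,κ}` (κ ≥ 1): a center adjacent to every other vertex,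
every edge meets the center, and there is at least one other vertex. -/
def IsStar {α : Type*} (G : SimpleGraph α) : Prop :=
  ∃ c : α, (∃ v, v ≠ c) ∧ (∀ v, v ≠ c → G.Adj c v) ∧ ∀ ⦃x y⦄, G.Adj x y → x = c ∨ y = c

/-- A star forest: every connected component is a star. -/
def IsStarForest {α : Type*} (G : SimpleGraph α) : Prop :=
  ∀ C : G.ConnectedComponent, IsStar (G.induce C.supp)

/-- The star `S_n` with `n` edges: center `none`, leaves `some i`. -/
def starGraph (n : ℕ) : SimpleGraph (Option (Fin n)) :=
  SimpleGraph.fromRel fun a b => a = none ∨ b = none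

/-- Disjoint union of two graphs. -/
def sumGraph {α β : Type*} (G : SimpleGraph α) (H : SimpleGraph β) : SimpleGraph (α ⊕ β) :=
  SimpleGraph.fromRel fun a b =>
    match a, b with
    | Sum.inl a, Sum.inl b => G.Adj a b
    | Sum.inr a, Sum.inr b => H.Adj a b
    | _, _ => False

/-- Disjoint union of a family of graphs. -/
def sigmaGraph {ι : Type*} {V : ι → Type*} (G : ∀ i, SimpleGraph (V i)) :
    SimpleGraph (Σ i, V i) :=
  SimpleGraph.fromRel fun a b => ∃ h : a.1 = b.1, (G b.1).Adj (h ▸ a.2) b.2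

/-- The double ray (two-way infinite path). -/
def doubleRay : SimpleGraph ℤ := SimpleGraph.fromRel fun a b => b = a + 1

/-- The ray (one-way infinite path). -/
def rayGraph : SimpleGraph ℕ := SimpleGraph.fromRel fun a b => b = a + 1

/-- `2S_1`: a matching with two edges. -/
def twoS1 : SimpleGraph (Fin 2 ⊕ Fin 2) :=
  sumGraph (⊤ : SimpleGraph (Fin 2)) (⊤ : SimpleGraph (Fin 2))

/-- `kℤ`: the disjoint union of `k` double rays. -/
def nZ (k : ℕ) : SimpleGraph (Σ _ : Fin k, ℤ) :=
  sigmaGraph fun _ : Fin k => doubleRay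

/-- The 4-cycle. -/
def cycle4 : SimpleGraph (ZMod 4) := SimpleGraph.fromRel fun a b => b = a + 1

/-- The subdivision graph `S(G)`: each edge of `G` gets a new subdividing vertex. -/
def subdivision {α : Type*} (G : SimpleGraph α) : SimpleGraph (α ⊕ G.edgeSet) :=
  SimpleGraph.fromRel fun a b =>
    match a, b with
    | Sum.inl v, Sum.inr e => v ∈ (e : Sym2 α)
    | _, _ => False

/-- The graph `Γ(K,A,n)`: to each `u ∈ A` of (finite) degree `m` we add `m·(n-1)` new
clones of `u`, each joined to precisely the neighbors of `u` in `K`. -/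
def Gamma {α : Type*} (K : SimpleGraph α) (A : Set α) (n : ℕ) :
    SimpleGraph (α ⊕ Σ u : A, Fin ((K.neighborSet (u : α)).ncard * (n - 1))) :=
  SimpleGraph.fromRel fun a b =>
    match a, b with
    | Sum.inl x, Sum.inl y => K.Adj x y
    | Sum.inl x, Sum.inr p => K.Adj (p.1 : α) x
    | _, _ => False

/-- The extension property of the Rado graph. -/
def ExtensionProperty {α : Type*} (R : SimpleGraph α) : Prop :=
  ∀ U W : Finset α, Disjoint U W →
    ∃ v, v ∉ U ∧ v ∉ W ∧ (∀ u ∈ U, R.Adj v u) ∧ ∀ w ∈ W, ¬ R.Adj v w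

/-- The set of subdividing vertices of `S(G)`. -/
def subdividers {α : Type*} (G : SimpleGraph α) : Set (α ⊕ G.edgeSet) :=
  Set.range Sum.inr

/-- Vertex type of `Γ(S(G), A, m)` with `A` the subdividing vertices. -/
abbrev GammaVert {α : Type*} (G : SimpleGraph α) (m : ℕ) :=
  (α ⊕ G.edgeSet) ⊕
    Σ u : subdividers G, Fin (((subdivision G).neighborSet (u : α ⊕ G.edgeSet)).ncard * (m - 1))

/-- `Γ = ⋃_{i} Γ(S(G), A, n i)` with `A` the subdividing vertices of `S(G)`. -/
def bigGamma {α : Type*} (G : SimpleGraph α) {k : ℕ} (n : Fin k → ℕ) :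
    SimpleGraph (Σ i : Fin k, GammaVert G (n i)) :=
  sigmaGraph fun i => Gamma (subdivision G) (subdividers G) (n i)

/-- The set `A_{u,i}` inside `Γ`: the copy of `u` in `Γ_i` together with all its clones. -/
def cloneSet {α : Type*} (G : SimpleGraph α) {k : ℕ} (n : Fin k → ℕ)
    (u : subdividers G) (i : Fin k) : Set (Σ i : Fin k, GammaVert G (n i)) :=
  {p | p = ⟨i, Sum.inl (u : α ⊕ G.edgeSet)⟩ ∨
    ∃ j : Fin (((subdivision G).neighborSet (u : α ⊕ G.edgeSet)).ncard * (n i - 1)),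
      p = ⟨i, Sum.inr ⟨u, j⟩⟩}

/-- The bipartite graph of a relation between two types. -/
def relGraph {A B : Type*} (R : A → B → Prop) : SimpleGraph (A ⊕ B) where
  Adj
    | Sum.inl a, Sum.inr b => R a b
    | Sum.inr b, Sum.inl a => R a b
    | _, _ => False
  symm := ⟨by rintro (a | b) (a' | b') h <;> exact h⟩
  loopless := ⟨by rintro (a | b) h <;> exact h⟩

/-- The graph consisting of one copy of `G` for each `i : ι`, in which each edge is replaced by
parallel paths of length two, one for each `t ∈ T` with first coordinate `i`. -/
def multiSubdivision {α ι κ : Type*} (G : SimpleGraph α) (T : Set (ι × κ)) :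
    SimpleGraph ((ι × α) ⊕ ((ι × κ) × G.edgeSet)) :=
  relGraph fun p q => q.1 ∈ T ∧ q.1.1 = p.1 ∧ p.2 ∈ (q.2 : Sym2 α)

/-- The star forest with centers `ι × Bool`, in which each `t ∈ T` is a leaf attached to the
center `(t.1, ε t)`. -/
def doubleStars {ι κ : Type*} (T : Set (ι × κ)) (ε : ι × κ → Bool) :
    SimpleGraph ((ι × Bool) ⊕ (ι × κ)) :=
  relGraph fun p t => t ∈ T ∧ t.1 = p.1 ∧ ε t = p.2

lemma relGraph_adj_iff {A B : Type*} {R : A → B → Prop} {x y : A ⊕ B} :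
    (relGraph R).Adj x y ↔
      ∃ a b, R a b ∧ (x = Sum.inl a ∧ y = Sum.inr b ∨ x = Sum.inr b ∧ y = Sum.inl a) := by
  rcases x with a | b <;> rcases y with a' | b' <;> simp [relGraph]

lemma subdivision_adj_iff {α : Type*} {G : SimpleGraph α} {x y : α ⊕ G.edgeSet} :
    (subdivision G).Adj x y ↔ ∃ (v : α) (e : G.edgeSet), v ∈ (e : Sym2 α) ∧
      (x = Sum.inl v ∧ y = Sum.inr e ∨ x = Sum.inr e ∧ y = Sum.inl v) := by
  rcases x with a | b <;> rcases y with a' | b' <;> simp [subdivision]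

lemma exists_endpoints {α : Type*} {G : SimpleGraph α} (e : G.edgeSet) :
    ∃ p : Bool → α, Function.Injective p ∧ ∀ v, v ∈ (e : Sym2 α) ↔ ∃ b, p b = v := by
  obtain ⟨e, he⟩ := e
  induction e with
  | h a b =>
    have hab : a ≠ b := G.ne_of_adj he
    refine ⟨fun i => if i then a else b, ?_, ?_⟩
    · intro i j h
      cases i <;> cases j <;> simp_all
    · intro v
      simp [eq_comm, or_comm]

lemma edge_eq_of_mem {α : Type*} {G : SimpleGraph α} {e e' : G.edgeSet} {v w : α} (h : v ≠ w)
    (hv : v ∈ (e : Sym2 α)) (hw : w ∈ (e : Sym2 α)) (hv' : v ∈ (e' : Sym2 α))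
    (hw' : w ∈ (e' : Sym2 α)) : e = e' :=
  Subtype.ext (((Sym2.mem_and_mem_iff h).1 ⟨hv, hw⟩).trans
    ((Sym2.mem_and_mem_iff h).1 ⟨hv', hw'⟩).symm)

/-- An injective endomorphism of a non-self-embeddable graph hits every edge. -/
lemma exists_adj_preimage {α : Type*} {G : SimpleGraph α} (hG : ¬ SelfEmbeddable G) {φ : α → α}
    (hφ : Function.Injective φ) (hom : ∀ a b, G.Adj a b → G.Adj (φ a) (φ b)) {x y : α}
    (h : G.Adj x y) : ∃ a b, G.Adj a b ∧ φ a = x ∧ φ b = y := by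
  let G' : G.Subgraph :=
    { verts := Set.range φ
      Adj := fun x y => ∃ a b, G.Adj a b ∧ φ a = x ∧ φ b = y
      adj_sub := by rintro _ _ ⟨a, b, hab, rfl, rfl⟩; exact hom a b hab
      edge_vert := by rintro _ _ ⟨a, b, hab, rfl, rfl⟩; exact ⟨a, rfl⟩
      symm := ⟨by rintro _ _ ⟨a, b, hab, rfl, rfl⟩; exact ⟨b, a, hab.symm, rfl, rfl⟩⟩ }
  have hG' : G' = ⊤ := by
    by_contra hne
    refine hG ⟨G', hne, ⟨⟨Equiv.ofInjective φ hφ, ?_⟩⟩⟩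
    intro a b
    refine ⟨?_, fun hab => ⟨a, b, hab, rfl, rfl⟩⟩
    rintro ⟨a', b', hab, ha, hb⟩
    rwa [← hφ ha, ← hφ hb]
  have : G'.Adj x y := by rw [hG']; exact h
  exact this

lemma eq_of_forall_adj {α X : Type*} {G : SimpleGraph α} (hG : G.Connected) {g : α → X}
    (h : ∀ a b, G.Adj a b → g a = g b) (a b : α) : g a = g b := by
  obtain ⟨p⟩ := hG.preconnected a b
  induction p with
  | nil => rfl
  | cons hab _ ih => exact (h _ _ hab).trans ih

section Copies

variable {α ι κ : Type*} {G : SimpleGraph α} {T : Set (ι × κ)}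
  {f : α ⊕ G.edgeSet → (ι × α) ⊕ ((ι × κ) × G.edgeSet)}

/-- Copies of `S(G)` that respect the bipartition. -/
lemma exists_path_of_inl (hGs : ¬ SelfEmbeddable G) (hf : Function.Injective f)
    (hom : ∀ (v : α) (e : G.edgeSet), v ∈ (e : Sym2 α) →
      (multiSubdivision G T).Adj (f (Sum.inl v)) (f (Sum.inr e)))
    {i : ι} {φ : α → α} (hφ : ∀ v, f (Sum.inl v) = Sum.inl (i, φ v)) (e₀ : G.edgeSet) :
    ∃ t ∈ T, ∀ u ∈ (e₀ : Sym2 α), ∃ (v : α) (e : G.edgeSet), v ∈ (e : Sym2 α) ∧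
      s(f (Sum.inl v), f (Sum.inr e)) = s(Sum.inl (t.1, u), Sum.inr (t, e₀)) := by
  have hedge : ∀ v (e : G.edgeSet), v ∈ (e : Sym2 α) → ∃ t ∈ T, ∃ e' : G.edgeSet, t.1 = i ∧
      φ v ∈ (e' : Sym2 α) ∧ f (Sum.inr e) = Sum.inr (t, e') := by
    intro v e hv
    have h := hom v e hv
    rw [hφ] at h
    obtain ⟨p, ⟨t, e'⟩, ⟨hT, hi, hm⟩, ⟨h1, h2⟩ | ⟨h1, h2⟩⟩ := relGraph_adj_iff.1 h
    · cases h1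
      exact ⟨t, hT, e', hi, hm, h2⟩
    · cases h1
  have hinj : Function.Injective φ := by
    intro v w h
    have : f (Sum.inl v) = f (Sum.inl w) := by rw [hφ, hφ, h]
    exact Sum.inl_injective (hf this)
  have hends : ∀ v w (h : G.Adj v w), ∃ t ∈ T, ∃ e' : G.edgeSet, t.1 = i ∧
      φ v ∈ (e' : Sym2 α) ∧ φ w ∈ (e' : Sym2 α) ∧ f (Sum.inr ⟨s(v, w), h⟩) = Sum.inr (t, e') := by
    intro v w h
    obtain ⟨t, hT, e', hi, hm, h1⟩ := hedge v ⟨s(v, w), h⟩ (by simp)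
    obtain ⟨t', -, e'', -, hm', h2⟩ := hedge w ⟨s(v, w), h⟩ (by simp)
    rw [h1] at h2
    cases h2
    exact ⟨t, hT, e', hi, hm, hm', h1⟩
  have hhom : ∀ a b, G.Adj a b → G.Adj (φ a) (φ b) := by
    intro a b h
    obtain ⟨t, -, ⟨e', he'⟩, -, ha, hb, -⟩ := hends a b h
    have : e' = s(φ a, φ b) := (Sym2.mem_and_mem_iff (hinj.ne (G.ne_of_adj h))).1 ⟨ha, hb⟩
    rwa [this] at he'
  obtain ⟨e, he⟩ := e₀
  induction e with
  | h x y =>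
    obtain ⟨a, b, hab, rfl, rfl⟩ := exists_adj_preimage hGs hinj hhom he
    obtain ⟨t, hT, e', hi, ha, hb, hfe⟩ := hends a b hab
    have hee : e' = ⟨s(φ a, φ b), he⟩ :=
      edge_eq_of_mem (hinj.ne (G.ne_of_adj hab)) ha hb (by simp) (by simp)
    subst hee
    refine ⟨t, hT, ?_⟩
    intro u hu
    rcases Sym2.mem_iff.1 hu with rfl | rfl
    · exact ⟨a, ⟨s(a, b), hab⟩, by simp, by rw [hφ, hfe, hi]⟩
    · exact ⟨b, ⟨s(a, b), hab⟩, by simp, by rw [hφ, hfe, hi]⟩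

/-- Copies of `S(G)` that swap the two sides of the bipartition; here `G` is 2-regular. -/
lemma exists_path_of_inr (hGc : G.Connected)
    (hdeg : ∀ v, ∃ w w', w ≠ w' ∧ G.Adj v w ∧ G.Adj v w') (hf : Function.Injective f)
    (hom : ∀ (v : α) (e : G.edgeSet), v ∈ (e : Sym2 α) →
      (multiSubdivision G T).Adj (f (Sum.inl v)) (f (Sum.inr e)))
    {t : α → ι × κ} {ψ : α → G.edgeSet} (hψ : ∀ v, f (Sum.inl v) = Sum.inr (t v, ψ v))
    (e₀ : G.edgeSet) :
    ∃ t ∈ T, ∀ u ∈ (e₀ : Sym2 α), ∃ (v : α) (e : G.edgeSet), v ∈ (e : Sym2 α) ∧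
      s(f (Sum.inl v), f (Sum.inr e)) = s(Sum.inl (t.1, u), Sum.inr (t, e₀)) := by
  have hvert : ∀ v (e : G.edgeSet), v ∈ (e : Sym2 α) → ∃ u, t v ∈ T ∧
      u ∈ (ψ v : Sym2 α) ∧ f (Sum.inr e) = Sum.inl ((t v).1, u) := by
    intro v e hv
    have h := hom v e hv
    rw [hψ] at h
    obtain ⟨⟨i, u⟩, q, ⟨hT, hi, hm⟩, ⟨h1, h2⟩ | ⟨h1, h2⟩⟩ := relGraph_adj_iff.1 h
    · cases h1
    · cases h1
      simp only at hi hm hT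
      exact ⟨u, hT, hm, by rw [h2, hi]⟩
  -- both halves of `ψ v` are used
  have hboth : ∀ v, ∀ u ∈ (ψ v : Sym2 α), ∃ w, ∃ h : G.Adj v w,
      f (Sum.inr ⟨s(v, w), h⟩) = Sum.inl ((t v).1, u) := by
    intro v u hu
    obtain ⟨w, w', hne, hw, hw'⟩ := hdeg v
    obtain ⟨a, -, ha, hfa⟩ := hvert v ⟨s(v, w), hw⟩ (by simp)
    obtain ⟨b, -, hb, hfb⟩ := hvert v ⟨s(v, w'), hw'⟩ (by simp)
    have hab : a ≠ b := by
      rintro rfl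
      have : s(v, w) = s(v, w') :=
        congrArg Subtype.val (Sum.inr_injective (hf (hfa.trans hfb.symm)))
      exact hne (Sym2.congr_right.1 this)
    have := (Sym2.mem_and_mem_iff hab).1 ⟨ha, hb⟩
    rw [this] at hu
    rcases Sym2.mem_iff.1 hu with rfl | rfl
    · exact ⟨w, hw, hfa⟩
    · exact ⟨w', hw', hfb⟩
  have hidx : ∀ v w, G.Adj v w → (t v).1 = (t w).1 := by
    intro v w h
    obtain ⟨a, -, -, ha⟩ := hvert v ⟨s(v, w), h⟩ (by simp)
    obtain ⟨b, -, -, hb⟩ := hvert w ⟨s(v, w), h⟩ (by simp)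
    have := ha.symm.trans hb
    simp only [Sum.inl.injEq, Prod.mk.injEq] at this
    exact this.1
  have hψinj : Function.Injective ψ := by
    intro v w hvw
    by_contra hne
    obtain ⟨p, hp, hpm⟩ := exists_endpoints (ψ v)
    have key : ∀ b, ∃ h : G.Adj v w, f (Sum.inr ⟨s(v, w), h⟩) = Sum.inl ((t v).1, p b) := by
      intro b
      have hb : p b ∈ (ψ v : Sym2 α) := (hpm _).2 ⟨b, rfl⟩
      obtain ⟨x, hx, hfx⟩ := hboth v _ hb
      obtain ⟨y, hy, hfy⟩ := hboth w (p b) (hvw ▸ hb)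
      rw [eq_of_forall_adj hGc hidx w v] at hfy
      have h : s(v, x) = s(w, y) :=
        congrArg Subtype.val (Sum.inr_injective (hf (hfx.trans hfy.symm)))
      have hxw : x = w := by
        rcases Sym2.eq_iff.1 h with ⟨h1, -⟩ | ⟨-, h1⟩
        · exact absurd h1 hne
        · exact h1
      subst hxw
      exact ⟨hx, hfx⟩
    obtain ⟨_, h1⟩ := key true
    obtain ⟨_, h2⟩ := key false
    have := h1.symm.trans h2
    simp only [Sum.inl.injEq, Prod.mk.injEq] at this
    exact absurd (hp this.2) (by simp)
  have hdeg2 : ∀ x y₁ y₂ y₃, G.Adj x y₁ → G.Adj x y₂ → G.Adj x y₃ → y₁ ≠ y₂ →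
      y₃ = y₁ ∨ y₃ = y₂ := by
    intro x y₁ y₂ y₃ h₁ h₂ h₃ hne
    obtain ⟨p, -, hpm⟩ := exists_endpoints (ψ x)
    have key : ∀ y (h : G.Adj x y), ∃ b, f (Sum.inr ⟨s(x, y), h⟩) = Sum.inl ((t x).1, p b) := by
      intro y h
      obtain ⟨u, -, hu, hfu⟩ := hvert x ⟨s(x, y), h⟩ (by simp)
      obtain ⟨b, rfl⟩ := (hpm u).1 hu
      exact ⟨b, hfu⟩
    have key' : ∀ y y' (h : G.Adj x y) (h' : G.Adj x y') b,
        f (Sum.inr ⟨s(x, y), h⟩) = Sum.inl ((t x).1, p b) →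
        f (Sum.inr ⟨s(x, y'), h'⟩) = Sum.inl ((t x).1, p b) → y = y' := by
      intro y y' h h' b hb hb'
      have : s(x, y) = s(x, y') :=
        congrArg Subtype.val (Sum.inr_injective (hf (hb.trans hb'.symm)))
      exact Sym2.congr_right.1 this
    obtain ⟨b₁, hb₁⟩ := key y₁ h₁
    obtain ⟨b₂, hb₂⟩ := key y₂ h₂
    obtain ⟨b₃, hb₃⟩ := key y₃ h₃
    have hb : b₁ ≠ b₂ := fun h => hne (key' _ _ h₁ h₂ b₁ hb₁ (h ▸ hb₂))
    have hb' : b₃ = b₁ ∨ b₃ = b₂ := by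
      revert hb
      cases b₁ <;> cases b₂ <;> cases b₃ <;> simp
    rcases hb' with h | h
    · exact Or.inl (key' _ _ h₃ h₁ b₃ hb₃ (h ▸ hb₁))
    · exact Or.inr (key' _ _ h₃ h₂ b₃ hb₃ (h ▸ hb₂))
  have hstep : ∀ v u u' (h : G.Adj u u'), u ∈ (ψ v : Sym2 α) → ∃ v', ψ v' = ⟨s(u, u'), h⟩ := by
    intro v u u' h hu
    obtain ⟨w, hvw, hfw⟩ := hboth v u hu
    obtain ⟨u₁, -, hu₁, hfw'⟩ := hvert w ⟨s(v, w), hvw⟩ (by simp)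
    have huu : u = u₁ := by
      have := hfw.symm.trans hfw'
      simp only [Sum.inl.injEq, Prod.mk.injEq] at this
      exact this.2
    subst huu
    have hother : ∀ x, u ∈ (ψ x : Sym2 α) → ∃ a, ∃ h : G.Adj u a, ψ x = ⟨s(u, a), h⟩ := by
      intro x hx
      obtain ⟨a, ha⟩ := Sym2.mem_iff_exists.1 hx
      refine ⟨a, ?_, Subtype.ext ha⟩
      have := (ψ x).2
      rwa [ha] at this
    obtain ⟨a, ha, hψa⟩ := hother v hu
    obtain ⟨b, hb, hψb⟩ := hother w hu₁
    have hab : a ≠ b := by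
      rintro rfl
      exact G.ne_of_adj hvw (hψinj (hψa.trans hψb.symm))
    rcases hdeg2 u a b u' ha hb h hab with rfl | rfl
    · exact ⟨v, hψa⟩
    · exact ⟨w, hψb⟩
  have hcover : ∀ u, ∃ v, u ∈ (ψ v : Sym2 α) := by
    obtain ⟨v₀⟩ := hGc.nonempty
    obtain ⟨p, -, hpm⟩ := exists_endpoints (ψ v₀)
    have hiff : ∀ a b, G.Adj a b → (∃ v, a ∈ (ψ v : Sym2 α)) = ∃ v, b ∈ (ψ v : Sym2 α) := by
      have himp : ∀ a b, G.Adj a b → (∃ v, a ∈ (ψ v : Sym2 α)) → ∃ v, b ∈ (ψ v : Sym2 α) := by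
        rintro a b hab ⟨v, hv⟩
        obtain ⟨v', hv'⟩ := hstep v a b hab hv
        exact ⟨v', by simp [hv']⟩
      exact fun a b hab => propext ⟨himp a b hab, himp b a hab.symm⟩
    intro u
    rw [eq_of_forall_adj hGc (g := fun a => ∃ v, a ∈ (ψ v : Sym2 α)) hiff u (p true)]
    exact ⟨v₀, (hpm _).2 ⟨true, rfl⟩⟩
  obtain ⟨v, rfl⟩ : ∃ v, ψ v = e₀ := by
    obtain ⟨e, he⟩ := e₀
    induction e with
    | h x y =>
      obtain ⟨v, hv⟩ := hcover x
      exact hstep v x y he hv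
  refine ⟨t v, ?_, ?_⟩
  · obtain ⟨w, -, -, hw, -⟩ := hdeg v
    obtain ⟨-, hT, -, -⟩ := hvert v ⟨s(v, w), hw⟩ (by simp)
    exact hT
  · intro u hu
    obtain ⟨w, h, hfw⟩ := hboth v u hu
    exact ⟨v, ⟨s(v, w), h⟩, by simp, by rw [hψ, hfw, Sym2.eq_swap]⟩

/-- Given an edge `e₀` of `G`, every copy of `S(G)` in `multiSubdivision G T` contains one of the
paths of length two that replace `e₀`. -/
lemma exists_path (hGc : G.Connected) (hGs : ¬ SelfEmbeddable G)
    (hdeg : ∀ v, ∃ w w', w ≠ w' ∧ G.Adj v w ∧ G.Adj v w') (hf : Function.Injective f)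
    (hom : ∀ (v : α) (e : G.edgeSet), v ∈ (e : Sym2 α) →
      (multiSubdivision G T).Adj (f (Sum.inl v)) (f (Sum.inr e))) (e₀ : G.edgeSet) :
    ∃ t ∈ T, ∀ u ∈ (e₀ : Sym2 α), ∃ (v : α) (e : G.edgeSet), v ∈ (e : Sym2 α) ∧
      s(f (Sum.inl v), f (Sum.inr e)) = s(Sum.inl (t.1, u), Sum.inr (t, e₀)) := by
  let g : (ι × α) ⊕ ((ι × κ) × G.edgeSet) → ι × Bool :=
    Sum.elim (fun p => (p.1, true)) (fun q => (q.1.1, false))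
  have hg : ∀ x y, (multiSubdivision G T).Adj x y → g y = ((g x).1, !(g x).2) := by
    intro x y h
    obtain ⟨p, q, ⟨-, hi, -⟩, ⟨rfl, rfl⟩ | ⟨rfl, rfl⟩⟩ := relGraph_adj_iff.1 h <;> simp [g, hi]
  have hconst : ∀ a b, g (f (Sum.inl a)) = g (f (Sum.inl b)) := by
    refine eq_of_forall_adj (g := fun a => g (f (Sum.inl a))) hGc fun a b hab => ?_
    have ha := hg _ _ (hom a ⟨s(a, b), hab⟩ (by simp)).symm
    have hb := hg _ _ (hom b ⟨s(a, b), hab⟩ (by simp)).symm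
    exact ha.trans hb.symm
  obtain ⟨v₀⟩ := hGc.nonempty
  cases hfv : f (Sum.inl v₀) with
  | inl p =>
    have : ∀ v, ∃ u, f (Sum.inl v) = Sum.inl (p.1, u) := by
      intro v
      have h := hconst v v₀
      rw [hfv] at h
      rcases hv : f (Sum.inl v) with ⟨i, u⟩ | q
      · rw [hv] at h
        simp only [g, Sum.elim_inl, Prod.mk.injEq, and_true] at h
        exact ⟨u, by rw [h]⟩
      · simp [hv, g] at h
    choose φ hφ using this
    exact exists_path_of_inl hGs hf hom hφ e₀
  | inr q =>
    have : ∀ v, ∃ q', f (Sum.inl v) = Sum.inr q' := by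
      intro v
      have h := hconst v v₀
      rw [hfv] at h
      rcases hv : f (Sum.inl v) with p | q'
      · simp [hv, g] at h
      · exact ⟨q', rfl⟩
    choose q' hq' using this
    exact exists_path_of_inr hGc hdeg hf hom (t := fun v => (q' v).1) (ψ := fun v => (q' v).2)
      hq' e₀

end Copies
lemma Arrows.of_hom {α α' β γ : Type*} {F : SimpleGraph α} {F' : SimpleGraph α'}
    {G : SimpleGraph β} {H : SimpleGraph γ} (h : Arrows F G H) (g : α → α')
    (hg : Function.Injective g) (hom : ∀ x y, F.Adj x y → F'.Adj (g x) (g y)) :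
    Arrows F' G H := by
  intro c
  refine (h fun z => c (z.map g)).imp ?_ ?_
  all_goals
    rintro ⟨f, hf, hfa⟩
    exact ⟨g ∘ f, hg.comp hf, fun x y hxy => ⟨hom _ _ (hfa hxy).1, (hfa hxy).2⟩⟩

lemma HasMonoCopy.induce_support {X δ : Type*} {B : SimpleGraph X} {K : SimpleGraph δ}
    {col : Bool} {c : Sym2 X → Bool} {c' : Sym2 B.support → Bool}
    (hc : ∀ z, c (z.map Subtype.val) = c' z) (hK : ∀ x, ∃ y, K.Adj x y)
    (h : HasMonoCopy B c col K) : HasMonoCopy (B.induce B.support) c' col K := by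
  obtain ⟨f, hf, hfa⟩ := h
  have hs : ∀ x, f x ∈ B.support := by
    intro x
    obtain ⟨y, hy⟩ := hK x
    exact ⟨f y, (hfa hy).1⟩
  exact ⟨fun x => ⟨f x, hs x⟩, fun x y hxy => hf (congrArg Subtype.val hxy),
    fun x y hxy => ⟨(hfa hxy).1, (hc _).symm.trans (hfa hxy).2⟩⟩

lemma Arrows.induce_support {X β γ : Type*} {B : SimpleGraph X} {G : SimpleGraph β}
    {H : SimpleGraph γ} (hG : ∀ x, ∃ y, G.Adj x y) (hH : ∀ x, ∃ y, H.Adj x y)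
    (h : Arrows B G H) : Arrows (B.induce B.support) G H := by
  intro c
  have hc := (Sym2.map.injective (Subtype.val_injective (p := (· ∈ B.support)))).extend_apply c
    fun _ => true
  exact (h _).imp (HasMonoCopy.induce_support hc hG) (HasMonoCopy.induce_support hc hH)

/-- A graph that stops arrowing whenever an edge is deleted is minimal up to isolated vertices. -/
lemma isRamseyMinimal_induce_support {X β γ : Type*} {B : SimpleGraph X} {G : SimpleGraph β}
    {H : SimpleGraph γ} (hG : ∀ x, ∃ y, G.Adj x y) (hH : ∀ x, ∃ y, H.Adj x y)
    (h : Arrows B G H) (hdel : ∀ x y, B.Adj x y → ¬ Arrows (B.deleteEdges {s(x, y)}) G H) :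
    IsRamseyMinimal (B.induce B.support) G H := by
  refine ⟨h.induce_support hG hH, fun F' hF' hA => hF' ?_⟩
  have hadj : ∀ x y : B.support, B.Adj x y → F'.Adj x y := by
    intro x y hxy
    by_contra hn
    refine hdel x y hxy (hA.of_hom (fun z => z.1.1) ?_ ?_)
    · exact Subtype.val_injective.comp Subtype.val_injective
    · intro a b hab
      have hab' : F'.Adj a b := hab
      rw [deleteEdges_adj]
      refine ⟨F'.adj_sub hab', fun he => hn ?_⟩
      rcases Sym2.eq_iff.1 he with ⟨h1, h2⟩ | ⟨h1, h2⟩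
      · rwa [Subtype.ext h1, Subtype.ext h2] at hab'
      · rw [Subtype.ext h1, Subtype.ext h2] at hab'
        exact hab'.symm
  refine SimpleGraph.Subgraph.ext ?_ ?_
  · ext x
    simp only [Subgraph.verts_top, Set.mem_univ, iff_true]
    obtain ⟨y, hy⟩ := x.2
    exact F'.edge_vert (hadj x ⟨y, x, hy.symm⟩ hy)
  · ext x y
    exact ⟨fun hxy => F'.adj_sub hxy, hadj x y⟩

/-- `T` forces `H` if `H` embeds into every double star forest on `T`. -/
def ForcesStars {ι κ β : Type*} (T : Set (ι × κ)) (H : SimpleGraph β) : Prop :=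
  ∀ ε : ι × κ → Bool, Embeds H (doubleStars T ε)

lemma arrows_multiSubdivision {α ι κ β : Type*} {G : SimpleGraph α} {H : SimpleGraph β}
    {T : Set (ι × κ)} (h : ForcesStars T H) :
    Arrows (multiSubdivision G T) (subdivision G) H := by
  intro c
  by_cases hred : ∃ i : ι, ∀ e : G.edgeSet, ∃ k : κ, (i, k) ∈ T ∧
      ∀ v ∈ (e : Sym2 α), c s(Sum.inl (i, v), Sum.inr ((i, k), e)) = true
  · left
    obtain ⟨i, hi⟩ := hred
    choose k hkT hk using hi
    refine ⟨Sum.map (fun v => (i, v)) fun e => ((i, k e), e), ?_, ?_⟩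
    · exact Sum.map_injective.2 ⟨fun _ _ h => (Prod.mk.inj h).2, fun _ _ h => (Prod.mk.inj h).2⟩
    · intro x y hxy
      obtain ⟨v, e, hve, ⟨rfl, rfl⟩ | ⟨rfl, rfl⟩⟩ := subdivision_adj_iff.1 hxy
      · exact ⟨⟨hkT e, rfl, hve⟩, hk e v hve⟩
      · exact ⟨⟨hkT e, rfl, hve⟩, by rw [Sym2.eq_swap]; exact hk e v hve⟩
  · right
    push Not at hred
    choose e he using hred
    choose p hpinj hpm using fun i => exists_endpoints (e i)
    have hε : ∀ t : ι × κ, ∃ b : Bool, t ∈ T →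
        c s(Sum.inl (t.1, p t.1 b), Sum.inr (t, e t.1)) = false := by
      intro t
      by_cases ht : t ∈ T
      · obtain ⟨v, hv, hc⟩ := he t.1 t.2 ht
        obtain ⟨b, rfl⟩ := (hpm _ _).1 hv
        exact ⟨b, fun _ => by simpa using hc⟩
      · exact ⟨true, fun h => absurd h ht⟩
    choose ε hε using hε
    obtain ⟨f, hf, hfa⟩ := h ε
    have hg : Function.Injective (Sum.map (fun q : ι × Bool => (q.1, p q.1 q.2))
        fun t : ι × κ => (t, e t.1)) := by
      refine Sum.map_injective.2 ⟨?_, fun _ _ h => (Prod.mk.inj h).1⟩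
      rintro ⟨i, b⟩ ⟨j, b'⟩ h
      obtain ⟨h1, h2⟩ := Prod.mk.inj h
      simp only at h1 h2
      subst h1
      rw [hpinj i h2]
    refine ⟨_, hg.comp hf, ?_⟩
    intro x y hxy
    obtain ⟨⟨i, b⟩, t, ⟨hT, hi, hb⟩, ⟨h1, h2⟩ | ⟨h1, h2⟩⟩ := relGraph_adj_iff.1 (hfa hxy)
    all_goals
      simp only at hi hb
      subst hi hb
      simp only [Function.comp_apply, h1, h2, Sum.map_inl, Sum.map_inr]
    · exact ⟨⟨hT, rfl, (hpm _ _).2 ⟨_, rfl⟩⟩, hε t hT⟩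
    · exact ⟨⟨hT, rfl, (hpm _ _).2 ⟨_, rfl⟩⟩, by rw [Sym2.eq_swap]; exact hε t hT⟩

lemma not_arrows_deleteEdges {α ι κ β : Type*} {G : SimpleGraph α} {H : SimpleGraph β}
    {T : Set (ι × κ)} (hGc : G.Connected) (hGs : ¬ SelfEmbeddable G)
    (hdeg : ∀ v, ∃ w w', w ≠ w' ∧ G.Adj v w ∧ G.Adj v w') (hH : ∀ x, ∃ y, H.Adj x y)
    {t₀ : ι × κ} (hT : ¬ ForcesStars (T \ {t₀}) H) {v₀ : α} {e₀ : G.edgeSet}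
    (hv₀ : v₀ ∈ (e₀ : Sym2 α)) :
    ¬ Arrows ((multiSubdivision G T).deleteEdges {s(Sum.inl (t₀.1, v₀), Sum.inr (t₀, e₀))})
      (subdivision G) H := by
  classical
  obtain ⟨ε, hε⟩ := not_forall.1 hT
  obtain ⟨p, hp, hpm⟩ := exists_endpoints e₀
  intro hA
  rcases hA fun z => !decide (∃ t ∈ T \ {t₀}, z = s(Sum.inl (t.1, p (ε t)), Sum.inr (t, e₀)))
    with ⟨f, hf, hfa⟩ | ⟨f, hf, hfa⟩
  · have hadj : ∀ (v : α) (e : G.edgeSet), v ∈ (e : Sym2 α) →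
        (subdivision G).Adj (Sum.inl v) (Sum.inr e) := fun v e h =>
      subdivision_adj_iff.2 ⟨v, e, h, Or.inl ⟨rfl, rfl⟩⟩
    obtain ⟨t, ht, hall⟩ := exists_path (T := T) hGc hGs hdeg hf
      (fun v e h => (deleteEdges_adj.1 (hfa (hadj v e h)).1).1) e₀
    by_cases htt : t = t₀
    · subst htt
      obtain ⟨v, e, hve, heq⟩ := hall v₀ hv₀
      exact (deleteEdges_adj.1 (hfa (hadj v e hve)).1).2 heq
    · obtain ⟨v, e, hve, heq⟩ := hall (p (ε t)) ((hpm _).2 ⟨_, rfl⟩)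
      have := (hfa (hadj v e hve)).2
      simp only [Bool.not_eq_true', decide_eq_false_iff_not] at this
      exact this ⟨t, ⟨ht, htt⟩, heq⟩
  · have hblue : ∀ x y, H.Adj x y → ∃ t ∈ T \ {t₀},
        s(f x, f y) = s(Sum.inl (t.1, p (ε t)), Sum.inr (t, e₀)) := by
      intro x y hxy
      simpa using (hfa hxy).2
    let g : (ι × α) ⊕ ((ι × κ) × G.edgeSet) → (ι × Bool) ⊕ (ι × κ) :=
      Sum.map (fun q => (q.1, decide (q.2 = p true))) Prod.fst
    have hpd : ∀ b, decide (p b = p true) = b := by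
      intro b
      rw [decide_eq_decide.2 (hp.eq_iff (a := b) (b := true))]
      cases b <;> rfl
    have hval : ∀ x, (∃ i b, f x = Sum.inl (i, p b)) ∨ ∃ t, f x = Sum.inr (t, e₀) := by
      intro x
      obtain ⟨y, hy⟩ := hH x
      obtain ⟨t, -, ht⟩ := hblue x y hy
      rcases Sym2.eq_iff.1 ht with ⟨h, -⟩ | ⟨h, -⟩
      · exact Or.inl ⟨_, _, h⟩
      · exact Or.inr ⟨_, h⟩
    refine hε ⟨g ∘ f, ?_, ?_⟩
    · intro x y hxy
      apply hf
      rcases hval x with ⟨i, b, hx⟩ | ⟨t, hx⟩ <;> rcases hval y with ⟨i', b', hy⟩ | ⟨t', hy⟩ <;>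
        simp [g, hx, hy, -decide_eq_true_eq, hpd] at hxy
      · rw [hx, hy, hxy.1, hxy.2]
      · rw [hx, hy, hxy]
    · intro x y hxy
      obtain ⟨t, ht, heq⟩ := hblue x y hxy
      refine relGraph_adj_iff.2 ⟨(t.1, ε t), t, ⟨ht, rfl, rfl⟩, ?_⟩
      rcases Sym2.eq_iff.1 heq with ⟨h1, h2⟩ | ⟨h1, h2⟩
      · left; simp [g, h1, h2, hpd]
      · right; simp [g, h1, h2, hpd]

lemma IsStarForest.exists_center {β : Type*} {H : SimpleGraph β} (hH : IsStarForest H) :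
    ∃ c : β → β, (∀ x y, H.Adj x y → c x = c y ∧ (x = c x ∨ y = c y)) ∧
      ∀ x, ∃ y, H.Adj x y := by
  choose c hne hadj hstar using hH
  refine ⟨fun x => (c (H.connectedComponentMk x)).1, ?_, ?_⟩
  · intro x y hxy
    have hC : H.connectedComponentMk x = H.connectedComponentMk y :=
      ConnectedComponent.sound hxy.reachable
    simp only
    refine ⟨by rw [hC], ?_⟩
    have := hstar (H.connectedComponentMk x) (x := ⟨x, rfl⟩) (y := ⟨y, hC.symm⟩) hxy
    rw [← hC]
    exact this.imp (congrArg Subtype.val) (congrArg Subtype.val)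
  · intro x
    by_cases hx : (⟨x, rfl⟩ : (H.connectedComponentMk x).supp) = c (H.connectedComponentMk x)
    · obtain ⟨v, hv⟩ := hne (H.connectedComponentMk x)
      have := hadj _ v hv
      rw [← hx] at this
      exact ⟨v, this⟩
    · exact ⟨_, (hadj _ _ hx).symm⟩

lemma IsStarForest.exists_forcesStars {β : Type*} [Finite β] {H : SimpleGraph β}
    (hH : IsStarForest H) : ∃ T : Finset (β × ℕ), ForcesStars (T : Set (β × ℕ)) H := by
  classical
  cases nonempty_fintype β
  obtain ⟨c, hc, -⟩ := hH.exists_center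
  refine ⟨Finset.univ ×ˢ Finset.range (2 * Fintype.card β), fun ε => ?_⟩
  have hpig : ∀ i : β, ∃ b : Bool, ∃ g : β → ℕ, Function.Injective g ∧
      ∀ x, g x < 2 * Fintype.card β ∧ ε (i, g x) = b := by
    intro i
    obtain ⟨b, hb⟩ : ∃ b : Bool, Fintype.card β ≤
        ((Finset.range (2 * Fintype.card β)).filter fun k => ε (i, k) = b).card := by
      by_contra! h
      have h1 := h true
      have h2 := h false
      have := Finset.card_filter_add_card_filter_not (s := Finset.range (2 * Fintype.card β))
        (fun k => ε (i, k) = true)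
      simp only [Bool.not_eq_true, Finset.card_range] at this
      omega
    rw [← Fintype.card_coe] at hb
    obtain ⟨g⟩ := Function.Embedding.nonempty_of_card_le hb
    refine ⟨b, fun x => (g x).1, Subtype.val_injective.comp g.injective, fun x => ?_⟩
    simpa only [Finset.mem_filter, Finset.mem_range] using (g x).2
  choose b g hginj hg using hpig
  refine ⟨fun x => if x = c x then Sum.inl (c x, b (c x)) else Sum.inr (c x, g (c x) x), ?_, ?_⟩
  · intro x y hxy
    simp only at hxy
    split_ifs at hxy with hx hy hy
    · rw [hx, hy]
      exact (Prod.mk.inj (Sum.inl_injective hxy)).1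
    · obtain ⟨h1, h2⟩ := Prod.mk.inj (Sum.inr_injective hxy)
      rw [h1] at h2
      exact hginj _ h2
  · have key : ∀ x y, x ≠ y → c x = c y → x = c x →
        (doubleStars ((Finset.univ ×ˢ Finset.range (2 * Fintype.card β) : Finset (β × ℕ)) :
          Set (β × ℕ)) ε).Adj
          (if x = c x then Sum.inl (c x, b (c x)) else Sum.inr (c x, g (c x) x))
          (if y = c y then Sum.inl (c y, b (c y)) else Sum.inr (c y, g (c y) y)) := by
      intro x y hne hcc hx
      have hy : ¬ y = c y := fun hy => hne (hx.trans (hcc.trans hy.symm))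
      rw [if_pos hx, if_neg hy, hcc]
      refine ⟨?_, rfl, (hg _ _).2⟩
      simpa using (hg (c y) y).1
    intro x y hxy
    obtain ⟨hcc, hx | hy⟩ := hc x y hxy
    · exact key x y (H.ne_of_adj hxy) hcc hx
    · exact (key y x (H.ne_of_adj hxy).symm hcc.symm hy).symm

lemma isRamseyMinimal_of_isEmpty {α β γ : Type*} [IsEmpty α] [IsEmpty γ] (F : SimpleGraph α)
    (G : SimpleGraph β) (H : SimpleGraph γ) : IsRamseyMinimal F G H := by
  refine ⟨fun c => Or.inr ⟨isEmptyElim, fun x => isEmptyElim x, fun x => isEmptyElim x⟩, ?_⟩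
  intro F' hF'
  exact absurd (SimpleGraph.Subgraph.ext (Subsingleton.elim _ _) (Subsingleton.elim _ _)) hF'

lemma isRamseyMinimal_of_subsingleton {α β γ : Type*} [Unique α] [Nonempty β] [Subsingleton β]
    [Nonempty γ] (F : SimpleGraph α) (G : SimpleGraph β) (H : SimpleGraph γ) :
    IsRamseyMinimal F G H := by
  refine ⟨fun c => Or.inl ⟨fun _ => default, Function.injective_of_subsingleton _, ?_⟩, ?_⟩
  · intro x y hxy
    exact absurd (Subsingleton.elim x y) (G.ne_of_adj hxy)
  · intro F' hF' hA
    have hne : Nonempty F'.verts := by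
      obtain ⟨f, -⟩ | ⟨f, -⟩ := hA fun _ => true
      · exact ⟨f (Classical.arbitrary β)⟩
      · exact ⟨f (Classical.arbitrary γ)⟩
    obtain ⟨x, hx⟩ := hne
    refine hF' (SimpleGraph.Subgraph.ext ?_ ?_)
    · ext y
      simpa [Subsingleton.elim y x] using hx
    · ext y z
      refine ⟨fun h => F'.adj_sub h, fun h => ?_⟩
      exact absurd (Subsingleton.elim y z) (F.ne_of_adj h)

/-- Theorem 4 (main theorem 2): for `G` connected, leafless and non–self-embeddable and `H`
a finite star forest, there exists an `(S(G),H)`-minimal graph. -/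
theorem stmt_1 {α : Type u} {β : Type v} (G : SimpleGraph α)
    (hGc : G.Connected) (hGl : Leafless G) (hGs : ¬ SelfEmbeddable G)
    (H : SimpleGraph β) [Finite β] (hH : IsStarForest H) :
    ∃ (γ : Type (max u v)) (F : SimpleGraph γ), IsRamseyMinimal F (subdivision G) H := by
  obtain ⟨-, -, hHadj⟩ := hH.exists_center
  rcases isEmpty_or_nonempty β with hβ | hβ
  · exact ⟨PEmpty, ⊥, isRamseyMinimal_of_isEmpty _ _ _⟩
  have := hGc.nonempty
  rcases subsingleton_or_nontrivial α with hα | hα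
  · have : IsEmpty G.edgeSet := by
      refine ⟨fun e => ?_⟩
      obtain ⟨p, hp, -⟩ := exists_endpoints e
      exact absurd (hp (Subsingleton.elim (p true) (p false))) (by simp)
    have : Subsingleton (α ⊕ G.edgeSet) := (Equiv.sumEmpty α G.edgeSet).subsingleton
    exact ⟨PUnit, ⊥, isRamseyMinimal_of_subsingleton _ _ _⟩
  have hdeg : ∀ v, ∃ w w', w ≠ w' ∧ G.Adj v w ∧ G.Adj v w' := by
    intro v
    obtain ⟨w, hw⟩ := hGc.preconnected.exists_adj_of_nontrivial v
    by_contra! h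
    refine hGl v ⟨w, hw, fun w' hw' => ?_⟩
    by_contra hne
    exact h w w' (Ne.symm hne) hw hw'
  have hSadj : ∀ x, ∃ y, (subdivision G).Adj x y := by
    rintro (v | e)
    · obtain ⟨w, -, -, hw, -⟩ := hdeg v
      exact ⟨Sum.inr ⟨s(v, w), hw⟩,
        subdivision_adj_iff.2 ⟨v, ⟨s(v, w), hw⟩, by simp, Or.inl ⟨rfl, rfl⟩⟩⟩
    · obtain ⟨p, -, hp⟩ := exists_endpoints e
      exact ⟨Sum.inl (p true), subdivision_adj_iff.2 ⟨_, e, (hp _).2 ⟨_, rfl⟩, Or.inr ⟨rfl, rfl⟩⟩⟩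
  obtain ⟨T₁, hT₁⟩ := hH.exists_forcesStars
  obtain ⟨T, hT, hmin⟩ := wellFounded_lt.has_min
    {T : Finset (β × ℕ) | ForcesStars (T : Set (β × ℕ)) H} ⟨T₁, hT₁⟩
  have hdel : ∀ (v : α) (t : β × ℕ) (e : G.edgeSet), t ∈ T → v ∈ (e : Sym2 α) →
      ¬ Arrows ((multiSubdivision G (T : Set (β × ℕ))).deleteEdges
        {s(Sum.inl (t.1, v), Sum.inr (t, e))}) (subdivision G) H := by
    classical
    intro v t e ht hve
    refine not_arrows_deleteEdges hGc hGs hdeg hHadj (fun hF => ?_) hve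
    rw [← Finset.coe_erase] at hF
    exact hmin _ hF (Finset.erase_ssubset ht)
  refine ⟨_, _, isRamseyMinimal_induce_support hSadj hHadj
    (arrows_multiSubdivision (G := G) (T := (T : Set (β × ℕ))) hT) ?_⟩
  intro x y hxy
  obtain ⟨⟨i, v⟩, ⟨t, e⟩, ⟨ht, hi, hve⟩, ⟨rfl, rfl⟩ | ⟨rfl, rfl⟩⟩ := relGraph_adj_iff.1 hxy
  · simp only at hi
    subst hi
    exact hdel v t e ht hve
  · simp only at hi
    subst hi
    rw [Sym2.eq_swap]
    exact hdel v t e ht hve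
end

section
/- A graph G is self-embeddable if and only if at least one of the following holds: (i) some connected component of G is self-embeddable; or (ii) there exists an infinite sequence (C_i)_{i∈ℕ} of pairwise distinct connected components of G such that C_1 ≤ C_2 ≤ C_3 ≤ ⋯, i.e., C_i embeds into C_{i+1} for every i. -/
open SimpleGraph

universe u v w x

/-- Self-embeddability in terms of maps: some injective endomorphism misses a vertex or an edge. -/
theorem selfEmbeddable_iff_exists_hom {α : Type*} (G : SimpleGraph α) :
    SelfEmbeddable G ↔ ∃ f : G →g G, Function.Injective f ∧
      ¬ (Function.Surjective f ∧ ∀ x y, G.Adj (f x) (f y) → G.Adj x y) := by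
  constructor
  · rintro ⟨G', hG', ⟨e⟩⟩
    refine ⟨G'.hom.comp e.toHom, Subtype.val_injective.comp e.injective, ?_⟩
    rintro ⟨hsurj, hadj⟩
    have hverts : ∀ v, v ∈ G'.verts := fun v => by
      obtain ⟨x, rfl⟩ := hsurj v
      exact (e x).2
    apply hG'
    ext v w
    · simp [hverts]
    · refine ⟨fun h => h.adj_sub, fun h => ?_⟩
      obtain ⟨x, rfl⟩ := hsurj v
      obtain ⟨y, rfl⟩ := hsurj w
      exact e.map_adj_iff.2 (hadj x y h)
  · rintro ⟨f, hf, hproper⟩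
    refine ⟨(⊤ : G.Subgraph).map f, fun htop => hproper ⟨fun v => ?_, fun x y h => ?_⟩, ?_⟩
    · have hv : v ∈ ((⊤ : G.Subgraph).map f).verts := by rw [htop]; trivial
      obtain ⟨x, -, hx⟩ := hv
      exact ⟨x, hx⟩
    · have hxy : ((⊤ : G.Subgraph).map f).Adj (f x) (f y) := by rw [htop]; exact h
      obtain ⟨a, b, hab, ha, hb⟩ := hxy
      rw [← hf ha, ← hf hb]
      exact hab
    · refine ⟨⟨Equiv.ofBijective
        (fun x => (⟨f x, x, trivial, rfl⟩ : ((⊤ : G.Subgraph).map f).verts)) ⟨?_, ?_⟩, ?_⟩⟩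
      · exact fun x y h => hf (congrArg Subtype.val h)
      · rintro ⟨_, x, -, rfl⟩
        exact ⟨x, rfl⟩
      · intro x y
        constructor
        · rintro ⟨a, b, hab, ha, hb⟩
          rw [← hf ha, ← hf hb]
          exact hab
        · exact fun h => ⟨x, y, h, rfl, rfl⟩

/-- Embeddings of the components into pairwise distinct components glue to an injective
endomorphism of the whole graph. -/
theorem exists_hom_of_component_homs {α : Type*} (G : SimpleGraph α)
    (φ : G.ConnectedComponent → G.ConnectedComponent) (hφ : Function.Injective φ)
    (g : ∀ D : G.ConnectedComponent, G.induce D.supp →g G.induce (φ D).supp)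
    (hg : ∀ D, Function.Injective (g D)) :
    ∃ f : G →g G, Function.Injective f ∧
      ∀ (D : G.ConnectedComponent) (x : D.supp), f x = (g D x : α) := by
  let F : α → α := fun v => (g (G.connectedComponentMk v) ⟨v, rfl⟩ : α)
  have hF : ∀ (D : G.ConnectedComponent) (x : D.supp), F x = (g D x : α) := by
    rintro _ ⟨x, rfl⟩
    rfl
  refine ⟨⟨F, ?_⟩, ?_, hF⟩
  · intro x y hxy
    have hy : G.connectedComponentMk y = G.connectedComponentMk x :=
      (ConnectedComponent.sound hxy.reachable).symm
    rw [hF (G.connectedComponentMk x) ⟨x, rfl⟩, hF (G.connectedComponentMk x) ⟨y, hy⟩]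
    exact (g (G.connectedComponentMk x)).map_adj
      (show (G.induce (G.connectedComponentMk x).supp).Adj ⟨x, rfl⟩ ⟨y, hy⟩ from hxy)
  · intro x y hxy
    change F x = F y at hxy
    have hcomp : ∀ v, G.connectedComponentMk (F v) = φ (G.connectedComponentMk v) :=
      fun v => (g (G.connectedComponentMk v) ⟨v, rfl⟩).2
    have hy : G.connectedComponentMk y = G.connectedComponentMk x :=
      hφ (by rw [← hcomp, ← hcomp, hxy])
    rw [hF (G.connectedComponentMk x) ⟨x, rfl⟩, hF (G.connectedComponentMk x) ⟨y, hy⟩] at hxy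
    exact congrArg Subtype.val (hg _ (Subtype.ext hxy))

theorem SelfEmbeddable.of_component {α : Type*} {G : SimpleGraph α} {C : G.ConnectedComponent}
    (h : SelfEmbeddable (G.induce C.supp)) : SelfEmbeddable G := by
  classical
  obtain ⟨f, hf, hproper⟩ := (selfEmbeddable_iff_exists_hom _).1 h
  have hex : ∀ D : G.ConnectedComponent, ∃ k : G.induce D.supp →g G.induce D.supp,
      Function.Injective k ∧ ∀ hD : D = C, ∀ x : D.supp, (k x : α) = f ⟨x, hD ▸ x.2⟩ := by
    intro D
    by_cases hD : D = C
    · subst hD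
      exact ⟨f, hf, fun _ _ => rfl⟩
    · exact ⟨Hom.id, fun _ _ h => h, fun h => absurd h hD⟩
  choose g hg hgf using hex
  obtain ⟨F, hF, hFg⟩ := exists_hom_of_component_homs G id Function.injective_id g hg
  have hFf : ∀ x : C.supp, F x = (f x : α) := fun x => (hFg C x).trans (hgf C rfl x)
  refine (selfEmbeddable_iff_exists_hom G).2 ⟨F, hF, fun ⟨hsurj, hadj⟩ => hproper ⟨?_, ?_⟩⟩
  · rintro ⟨v, hv⟩
    obtain ⟨x, rfl⟩ := hsurj v
    have hx : G.connectedComponentMk x = C := by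
      have h1 := (g (G.connectedComponentMk x) ⟨x, rfl⟩).2
      rw [← hFg] at h1
      exact h1.symm.trans hv
    exact ⟨⟨x, hx⟩, Subtype.ext (hFf ⟨x, hx⟩).symm⟩
  · intro x y hxy
    refine hadj x y ?_
    rw [hFf, hFf]
    exact hxy

theorem SelfEmbeddable.of_component_chain {α : Type*} {G : SimpleGraph α}
    {C : ℕ → G.ConnectedComponent} (hC : Function.Injective C)
    (h : ∀ i, Embeds (G.induce (C i).supp) (G.induce (C (i + 1)).supp)) :
    SelfEmbeddable G := by
  classical
  let φ : G.ConnectedComponent → G.ConnectedComponent :=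
    Function.extend C (fun i => C (i + 1)) id
  have hφC : ∀ i, φ (C i) = C (i + 1) := fun i => hC.extend_apply _ _ i
  have hφid : ∀ D, (¬ ∃ i, C i = D) → φ D = D := fun D hD => Function.extend_apply' _ _ D hD
  have hφ : Function.Injective φ := by
    intro D E hDE
    by_cases hD : ∃ i, C i = D <;> by_cases hE : ∃ i, C i = E
    · obtain ⟨i, rfl⟩ := hD
      obtain ⟨j, rfl⟩ := hE
      rw [hφC, hφC] at hDE
      rw [Nat.succ_injective (hC hDE)]
    · obtain ⟨i, rfl⟩ := hD
      rw [hφC, hφid E hE] at hDE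
      exact absurd ⟨_, hDE⟩ hE
    · obtain ⟨j, rfl⟩ := hE
      rw [hφC, hφid D hD] at hDE
      exact absurd ⟨_, hDE.symm⟩ hD
    · rwa [hφid D hD, hφid E hE] at hDE
  have hex : ∀ D : G.ConnectedComponent, ∃ k : G.induce D.supp →g G.induce (φ D).supp,
      Function.Injective k := by
    intro D
    by_cases hD : ∃ i, C i = D
    · obtain ⟨i, rfl⟩ := hD
      rw [hφC]
      obtain ⟨k, hk, hadj⟩ := h i
      exact ⟨⟨k, fun h => hadj h⟩, hk⟩
    · rw [hφid D hD]
      exact ⟨Hom.id, fun _ _ h => h⟩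
  choose g hg using hex
  obtain ⟨F, hF, hFg⟩ := exists_hom_of_component_homs G φ hφ g hg
  refine (selfEmbeddable_iff_exists_hom G).2 ⟨F, hF, fun ⟨hsurj, _⟩ => ?_⟩
  obtain ⟨v, hv⟩ := (C 0).nonempty_supp
  obtain ⟨x, rfl⟩ := hsurj v
  have hx : φ (G.connectedComponentMk x) = C 0 := by
    have h1 := (g (G.connectedComponentMk x) ⟨x, rfl⟩).2
    rw [← hFg] at h1
    exact h1.symm.trans hv
  by_cases hD : ∃ i, C i = G.connectedComponentMk x
  · obtain ⟨i, hi⟩ := hD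
    rw [← hi, hφC] at hx
    exact absurd (hC hx) (Nat.succ_ne_zero i)
  · rw [hφid _ hD] at hx
    exact hD ⟨0, hx.symm⟩

/-- If no component is self-embeddable, an injective endomorphism mapping a component into itself
restricts to an automorphism of that component. -/
theorem surjective_of_not_selfEmbeddable_component {α : Type*} {G : SimpleGraph α}
    {D : G.ConnectedComponent} (hD : ¬ SelfEmbeddable (G.induce D.supp)) (f : G →g G)
    (hf : Function.Injective f) (hfD : ∀ v ∈ D.supp, f v ∈ D.supp) :
    (∀ v ∈ D.supp, ∃ u ∈ D.supp, f u = v) ∧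
      ∀ x ∈ D.supp, ∀ y ∈ D.supp, G.Adj (f x) (f y) → G.Adj x y := by
  by_contra hcon
  refine hD ((selfEmbeddable_iff_exists_hom _).2
    ⟨⟨fun v => ⟨f v, hfD v v.2⟩, fun h => f.map_adj h⟩,
      fun x y h => Subtype.ext (hf (congrArg Subtype.val h)), ?_⟩)
  rintro ⟨hsurj, hadj⟩
  refine hcon ⟨fun v hv => ?_, fun x hx y hy h => hadj ⟨x, hx⟩ ⟨y, hy⟩ h⟩
  obtain ⟨u, hu⟩ := hsurj ⟨v, hv⟩
  exact ⟨u, u.2, congrArg Subtype.val hu⟩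

theorem SelfEmbeddable.component_or_chain {α : Type*} {G : SimpleGraph α}
    (h : SelfEmbeddable G) :
    (∃ C : G.ConnectedComponent, SelfEmbeddable (G.induce C.supp)) ∨
      (∃ C : ℕ → G.ConnectedComponent, Function.Injective C ∧
        ∀ i : ℕ, Embeds (G.induce (C i).supp) (G.induce (C (i + 1)).supp)) := by
  obtain ⟨f, hf, hproper⟩ := (selfEmbeddable_iff_exists_hom G).1 h
  by_contra! hcon
  obtain ⟨hcomp, hchain⟩ := hcon
  let φ : G.ConnectedComponent → G.ConnectedComponent := ConnectedComponent.map f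
  have hmk : ∀ n v, G.connectedComponentMk (f^[n] v) = φ^[n] (G.connectedComponentMk v) := by
    intro n
    induction n with
    | zero => exact fun _ => rfl
    | succ n ih => exact fun v => ih (f v)
  have hhom : ∀ n x y, G.Adj x y → G.Adj (f^[n] x) (f^[n] y) := by
    intro n
    induction n with
    | zero => exact fun _ _ h => h
    | succ n ih => exact fun x y h => ih _ _ (f.map_adj h)
  have hperiodic : ∀ C : G.ConnectedComponent, ∃ i m, i < m ∧
      φ^[m] (φ^[i] C) = φ^[i] C := by
    intro C
    have hninj : ¬ Function.Injective (fun i => φ^[i] C) := by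
      intro hinj
      obtain ⟨i, hi⟩ := hchain _ hinj
      refine hi ⟨fun v => ⟨f v, ?_⟩, fun x y h => Subtype.ext (hf (congrArg Subtype.val h)),
        fun x y h => f.map_adj h⟩
      change φ (G.connectedComponentMk v) = φ^[i + 1] C
      rw [Function.iterate_succ_apply', show G.connectedComponentMk (v : α) = φ^[i] C from v.2]
    obtain ⟨i, j, hij, hlt⟩ : ∃ i j, φ^[i] C = φ^[j] C ∧ i < j := by
      simp only [Function.Injective, not_forall] at hninj
      obtain ⟨i, j, hij, hne⟩ := hninj
      rcases lt_or_gt_of_ne hne with hlt | hlt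
      · exact ⟨i, j, hij, hlt⟩
      · exact ⟨j, i, hij.symm, hlt⟩
    have hper : Function.IsPeriodicPt φ (j - i) (φ^[i] C) := by
      change φ^[j - i] (φ^[i] C) = φ^[i] C
      rw [← Function.iterate_add_apply, Nat.sub_add_cancel hlt.le, hij]
    exact ⟨i, (j - i) * (i + 1), by nlinarith [Nat.sub_pos_of_lt hlt], hper.mul_const (i + 1)⟩
  have hauto : ∀ C : G.ConnectedComponent, ∃ i m, i < m ∧
      (∀ v ∈ (φ^[i] C).supp, ∃ u ∈ (φ^[i] C).supp, f^[m] u = v) ∧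
      ∀ x ∈ (φ^[i] C).supp, ∀ y ∈ (φ^[i] C).supp,
        G.Adj (f^[m] x) (f^[m] y) → G.Adj x y := by
    intro C
    obtain ⟨i, m, him, hper⟩ := hperiodic C
    refine ⟨i, m, him, surjective_of_not_selfEmbeddable_component (hcomp _)
      ⟨f^[m], fun h => hhom m _ _ h⟩ (hf.iterate m) (D := φ^[i] C) (fun w hw => ?_)⟩
    change G.connectedComponentMk (f^[m] w) = _
    rw [hmk, show G.connectedComponentMk w = _ from hw, hper]
  have hcancel : ∀ i d u v, f^[i + d + 1] u = f^[i] v → f^[d + 1] u = v := by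
    intro i d u v huv
    apply hf.iterate i
    rw [← huv, ← Function.iterate_add_apply, add_assoc]
  refine hproper ⟨fun v => ?_, fun x y hxy => ?_⟩
  · obtain ⟨i, m, him, hsurj, -⟩ := hauto (G.connectedComponentMk v)
    obtain ⟨d, rfl⟩ := Nat.exists_eq_add_of_lt him
    obtain ⟨u, -, hu⟩ := hsurj _ (hmk i v)
    exact ⟨f^[d] u, by rw [← Function.iterate_succ_apply' (f := f), hcancel i d u v hu]⟩
  · obtain ⟨i, m, him, hsurj, hadj⟩ := hauto (G.connectedComponentMk (f x))
    obtain ⟨d, rfl⟩ := Nat.exists_eq_add_of_lt him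
    obtain ⟨u, hu, hux⟩ := hsurj _ (hmk i (f x))
    obtain ⟨w, hw, hwy⟩ := hsurj (f^[i] (f y)) (by
      change G.connectedComponentMk _ = _
      rw [hmk, ConnectedComponent.sound hxy.reachable])
    have huw : G.Adj u w := by
      refine hadj u hu w hw ?_
      rw [hux, hwy]
      exact hhom i _ _ hxy
    have hpull : ∀ a b, f^[i + d + 1] a = f^[i] (f b) → f^[d] a = b := by
      intro a b hab
      apply hf
      rw [← Function.iterate_succ_apply' (f := f), hcancel i d a (f b) hab]
    rw [← hpull u x hux, ← hpull w y hwy]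
    exact hhom d u w huw

/-- Proposition 1: `G` is self-embeddable iff some component is self-embeddable, or there is
an infinite sequence of pairwise distinct components each embedding into the next. -/
theorem stmt_3 {α : Type u} (G : SimpleGraph α) :
    SelfEmbeddable G ↔
      ((∃ C : G.ConnectedComponent, SelfEmbeddable (G.induce C.supp)) ∨
        (∃ C : ℕ → G.ConnectedComponent, Function.Injective C ∧
          ∀ i : ℕ, Embeds (G.induce (C i).supp) (G.induce (C (i + 1)).supp))) := by
  refine ⟨SelfEmbeddable.component_or_chain, ?_⟩
  rintro (⟨C, hC⟩ | ⟨C, hC, h⟩)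
  · exact hC.of_component
  · exact SelfEmbeddable.of_component_chain hC h
end

section
/- A star forest is self-embeddable if and only if it is infinite (i.e., has infinitely many vertices). -/
open SimpleGraph

universe u v w x

/-- An injective, non-surjective homomorphism from a graph to itself exhibits the graph as
self-embeddable. -/
theorem SelfEmbeddable.of_injective {α : Type*} {G : SimpleGraph α} (f : α → α)
    (hf : Function.Injective f) (hadj : ∀ ⦃x y⦄, G.Adj x y → G.Adj (f x) (f y)) {a : α}
    (ha : ∀ x, f x ≠ a) : SelfEmbeddable G := by
  let G' : G.Subgraph :=
    { verts := Set.range f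
      Adj := Relation.Map G.Adj f f
      adj_sub := by
        rintro _ _ ⟨x, y, h, rfl, rfl⟩
        exact hadj h
      edge_vert := by
        rintro _ _ ⟨x, y, h, rfl, rfl⟩
        exact ⟨x, rfl⟩
      symm := by
        constructor
        rintro _ _ ⟨x, y, h, rfl, rfl⟩
        exact ⟨y, x, h.symm, rfl, rfl⟩ }
  refine ⟨G', fun h => ?_, ⟨⟨Equiv.ofInjective f hf, ?_⟩⟩⟩
  · have : a ∈ G'.verts := h ▸ Set.mem_univ a
    obtain ⟨x, hx⟩ := this
    exact ha x hx
  · intro x y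
    constructor
    · rintro ⟨x', y', h, hx, hy⟩
      rwa [hf hx, hf hy] at h
    · intro h
      exact ⟨x, y, h, rfl, rfl⟩

/-- A self-embeddable graph is infinite. -/
theorem SelfEmbeddable.infinite {α : Type*} {G : SimpleGraph α} (hG : SelfEmbeddable G) :
    Infinite α := by
  by_contra hinf
  have : Finite α := not_infinite_iff_finite.mp hinf
  obtain ⟨G', hne, ⟨e⟩⟩ := hG
  let f : α → α := fun x => e x
  have hf : Function.Injective f := Subtype.val_injective.comp e.injective
  have hadj : ∀ x y, G.Adj x y ↔ G'.Adj (f x) (f y) := fun x y =>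
    (e.map_adj_iff (v := x) (w := y)).symm
  have hsurj : Function.Surjective f := Finite.surjective_of_injective hf
  let p : Equiv.Perm α := Equiv.ofBijective f ⟨hf, hsurj⟩
  have hpow : ∀ (n : ℕ) x y, G.Adj x y → G.Adj ((p ^ n) x) ((p ^ n) y) := by
    intro n
    induction n with
    | zero => intro x y h; simpa using h
    | succ n ih =>
      intro x y h
      rw [pow_succ]
      exact ih _ _ (G'.adj_sub ((hadj x y).1 h))
  have hback : ∀ x y, G.Adj (f x) (f y) → G.Adj x y := by
    intro x y h
    have hn : 0 < orderOf p := orderOf_pos p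
    have key := hpow (orderOf p - 1) _ _ h
    have hp : p ^ (orderOf p - 1) * p = 1 := by
      rw [← pow_succ, Nat.sub_add_cancel hn, pow_orderOf_eq_one]
    have hx : ∀ z, (p ^ (orderOf p - 1)) (f z) = z := fun z =>
      congrArg (fun q : Equiv.Perm α => q z) hp
    rwa [hx, hx] at key
  apply hne
  ext u v
  · obtain ⟨x, rfl⟩ := hsurj u
    simp [f]
  · obtain ⟨x, rfl⟩ := hsurj u
    obtain ⟨y, rfl⟩ := hsurj v
    rw [← hadj]
    exact ⟨fun h => G'.adj_sub ((hadj x y).1 h), hback x y⟩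

/-- In a star forest, every vertex can be assigned the center of its star. -/
theorem IsStarForest.exists_center_s4 {α : Type*} {G : SimpleGraph α} (hG : IsStarForest G) :
    ∃ c : α → α, (∀ v, c (c v) = c v) ∧
      ∀ x y, G.Adj x y ↔ x ≠ y ∧ c x = c y ∧ (x = c x ∨ y = c y) := by
  choose c _ hc hedge using hG
  have hcomp : ∀ v, G.connectedComponentMk (c (G.connectedComponentMk v) : α) =
      G.connectedComponentMk v := fun v => (c (G.connectedComponentMk v)).2
  have hcongr : ∀ {C D}, C = D → (c C : α) = c D := by
    rintro C _ rfl
    rfl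
  refine ⟨fun v => c (G.connectedComponentMk v), fun v => hcongr (hcomp v), fun x y => ?_⟩
  constructor
  · intro h
    have hxy : G.connectedComponentMk x = G.connectedComponentMk y :=
      ConnectedComponent.sound h.reachable
    refine ⟨h.ne, hcongr hxy, ?_⟩
    have := hedge (G.connectedComponentMk x) (x := ⟨x, rfl⟩) (y := ⟨y, hxy.symm⟩) h
    exact this.imp (congrArg Subtype.val)
      fun hy => (congrArg Subtype.val hy).trans (hcongr hxy)
  · have star : ∀ x y, x ≠ y → (c (G.connectedComponentMk x) : α) = c (G.connectedComponentMk y) →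
        x = c (G.connectedComponentMk x) → G.Adj x y := by
      intro x y hne hxy hx
      have h := hc (G.connectedComponentMk y) ⟨y, rfl⟩ (fun h => hne (by
        rw [hx, hxy, ← h]))
      have h' : G.Adj (c (G.connectedComponentMk y) : α) y := h
      rwa [← hxy, ← hx] at h'
    rintro ⟨hne, hxy, hx | hy⟩
    · exact star x y hne hxy hx
    · exact (star y x hne.symm hxy.symm hy).symm

/-- The shift along an injective sequence, fixing everything else. -/
theorem exists_shift {α : Type*} {e : ℕ → α} (he : Function.Injective e) :
    ∃ s : α → α, Function.Injective s ∧ (∀ n, s (e n) = e (n + 1)) ∧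
      (∀ v, v ∉ Set.range e → s v = v) ∧ ∀ v, s v ≠ e 0 := by
  let s : α → α := Function.extend e (fun n => e (n + 1)) id
  have hs : ∀ n, s (e n) = e (n + 1) := fun n => he.extend_apply _ _ n
  have hs' : ∀ v, v ∉ Set.range e → s v = v := fun v hv => Function.extend_apply' _ _ v hv
  refine ⟨s, fun v w h => ?_, hs, hs', fun v h => ?_⟩
  · by_cases hv : v ∈ Set.range e <;> by_cases hw : w ∈ Set.range e
    · obtain ⟨m, rfl⟩ := hv
      obtain ⟨n, rfl⟩ := hw
      rw [hs, hs] at h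
      rw [Nat.succ_injective (he h)]
    · obtain ⟨m, rfl⟩ := hv
      rw [hs, hs' w hw] at h
      exact absurd ⟨_, h⟩ hw
    · obtain ⟨n, rfl⟩ := hw
      rw [hs, hs' v hv] at h
      exact absurd ⟨_, h.symm⟩ hv
    · rwa [hs' v hv, hs' w hw] at h
  · by_cases hv : v ∈ Set.range e
    · obtain ⟨m, rfl⟩ := hv
      rw [hs] at h
      exact m.succ_ne_zero (he h)
    · rw [hs' v hv] at h
      exact hv ⟨0, h.symm⟩

/-- A star forest with an infinite star is self-embeddable. Here `c` sends each vertex to the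
center of its star. -/
theorem selfEmbeddable_of_infinite_leaves {α : Type*} {G : SimpleGraph α} {c : α → α}
    (hadj : ∀ x y, G.Adj x y ↔ x ≠ y ∧ c x = c y ∧ (x = c x ∨ y = c y))
    {a : α} (ha : {v | c v = a ∧ v ≠ a}.Infinite) : SelfEmbeddable G := by
  let e := ha.natEmbedding
  obtain ⟨s, hs, hse, hs', hs0⟩ := exists_shift (Subtype.val_injective.comp e.injective)
  have hcs : ∀ v, c (s v) = c v := by
    intro v
    by_cases hv : v ∈ Set.range (Subtype.val ∘ e)
    · obtain ⟨n, rfl⟩ := hv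
      rw [hse]
      exact (e (n + 1)).2.1.trans (e n).2.1.symm
    · rw [hs' v hv]
  have hcenter : ∀ v, v = c v → s v = v := by
    refine fun v hv => hs' v ?_
    rintro ⟨n, rfl⟩
    exact (e n).2.2 (hv.trans (e n).2.1)
  refine SelfEmbeddable.of_injective s hs (fun x y h => ?_) hs0
  obtain ⟨hne, hxy, h⟩ := (hadj x y).1 h
  refine (hadj _ _).2 ⟨hs.ne hne, by rw [hcs, hcs, hxy], h.imp (fun h => ?_) (fun h => ?_)⟩
  · rw [hcs, hcenter x h, ← h]
  · rw [hcs, hcenter y h, ← h]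

/-- A star forest with infinitely many stars is self-embeddable. Here `c` sends each vertex to the
center of its star. -/
theorem selfEmbeddable_of_infinite_centers {α : Type*} {G : SimpleGraph α} {c : α → α}
    (hc : ∀ v, c (c v) = c v)
    (hadj : ∀ x y, G.Adj x y ↔ x ≠ y ∧ c x = c y ∧ (x = c x ∨ y = c y))
    (hinf : (Set.range c).Infinite) : SelfEmbeddable G := by
  classical
  let L : α → Set α := fun a => {v | c v = a ∧ v ≠ a}
  let e₀ := hinf.natEmbedding
  obtain ⟨g, hg⟩ := (wellQuasiOrdered_le (α := Cardinal)).exists_monotone_subseq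
    fun n => Cardinal.mk (L (e₀ n))
  let e : ℕ → α := fun n => e₀ (g n)
  have he : Function.Injective e :=
    Subtype.val_injective.comp (e₀.injective.comp g.injective)
  have hce : ∀ n, c (e n) = e n := by
    intro n
    obtain ⟨v, hv⟩ := (e₀ (g n)).2
    change c v = e n at hv
    rw [← hv, hc]
  obtain ⟨s, hs, hse, hs', hs0⟩ := exists_shift he
  have hcs : ∀ a, c a = a → c (s a) = s a := by
    intro a ha
    by_cases hv : a ∈ Set.range e
    · obtain ⟨n, rfl⟩ := hv
      rw [hse, hce]
    · rw [hs' a hv, ha]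
  have hL : ∀ a, Nonempty (L a ↪ L (s a)) := by
    intro a
    by_cases hv : a ∈ Set.range e
    · obtain ⟨n, rfl⟩ := hv
      rw [hse]
      exact hg n (n + 1) n.le_succ
    · rw [hs' a hv]
      exact ⟨Function.Embedding.refl _⟩
  let φ := fun a => (hL a).some
  let f : α → α := fun v => if h : v = c v then s v else φ (c v) ⟨v, rfl, h⟩
  have hf_center : ∀ v, v = c v → f v = s v := fun v h => dif_pos h
  have hf_leaf : ∀ v (h : v ≠ c v), f v = φ (c v) ⟨v, rfl, h⟩ := fun v h => dif_neg h
  have hcf : ∀ v, c (f v) = s (c v) := by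
    intro v
    by_cases h : v = c v
    · rw [hf_center v h, hcs v h.symm, ← h]
    · rw [hf_leaf v h]
      exact (φ (c v) ⟨v, rfl, h⟩).2.1
  have hf_iff : ∀ v, f v = c (f v) ↔ v = c v := by
    intro v
    refine ⟨fun hv => ?_, fun h => ?_⟩
    · by_contra h
      rw [hcf, hf_leaf v h] at hv
      exact (φ (c v) ⟨v, rfl, h⟩).2.2 hv
    · rw [hcf, hf_center v h, ← h]
  have hf : Function.Injective f := by
    intro v w h
    have hcvw : c v = c w := hs (by rw [← hcf, ← hcf, h])
    have hiff : v = c v ↔ w = c w := by rw [← hf_iff v, ← hf_iff w, h]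
    by_cases hv : v = c v
    · exact hv.trans (hcvw.trans (hiff.1 hv).symm)
    · have hw := hiff.not.1 hv
      have key : ∀ a b (hab : a = b) (x : L a) (y : L b), (φ a x : α) = φ b y → (x : α) = y := by
        rintro a _ rfl x y hxy
        rw [(φ a).injective (Subtype.ext hxy)]
      exact key _ _ hcvw ⟨v, rfl, hv⟩ ⟨w, rfl, hw⟩ (by rw [← hf_leaf v hv, ← hf_leaf w hw, h])
  refine SelfEmbeddable.of_injective f hf (fun x y h => ?_) (a := e 0) fun v hv => ?_
  · obtain ⟨hne, hxy, h⟩ := (hadj x y).1 h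
    exact (hadj _ _).2 ⟨hf.ne hne, by rw [hcf, hcf, hxy], h.imp (hf_iff x).2 (hf_iff y).2⟩
  · exact hs0 (c v) (by rw [← hcf, hv, hce])

/-- Corollary 1: a star forest is self-embeddable iff it has infinitely many vertices. -/
theorem stmt_4 {α : Type u} (G : SimpleGraph α) (hG : IsStarForest G) :
    SelfEmbeddable G ↔ Infinite α := by
  refine ⟨SelfEmbeddable.infinite, fun hinf => ?_⟩
  obtain ⟨c, hc, hadj⟩ := hG.exists_center_s4
  by_cases hcenters : (Set.range c).Infinite
  · exact selfEmbeddable_of_infinite_centers hc hadj hcenters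
  by_cases hleaves : ∃ a, {v | c v = a ∧ v ≠ a}.Infinite
  · obtain ⟨a, ha⟩ := hleaves
    exact selfEmbeddable_of_infinite_leaves hadj ha
  · simp only [not_exists, Set.not_infinite] at hcenters hleaves
    refine absurd (hcenters.union (hcenters.biUnion fun a _ => hleaves a))
      (Set.Infinite.mono (fun v _ => ?_) Set.infinite_univ)
    by_cases h : v = c v
    · exact Or.inl ⟨v, h.symm⟩
    · exact Or.inr (Set.mem_biUnion ⟨v, rfl⟩ ⟨rfl, h⟩)
end

section
/- Let G be a nonempty graph such that G embeds into G − e for every edge e of G, let H be any graph, and let F be a graph with F → (G,H). Then for every edge e of F, F − e → (G,H). In particular, if F − e admits a (G,H)-good coloring for some edge e of F, then F admits a (G,H)-good coloring. -/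
open SimpleGraph

universe u v w x

/-- If every edge of `G` can be avoided by a self-embedding, a monochromatic copy of `G` in `F`
yields one in `F - e`, for any coloring agreeing with the old one off `e`. -/
theorem HasMonoCopy.deleteEdge {α : Type*} {γ : Type*} {G : SimpleGraph α} {F : SimpleGraph γ}
    {c c' : Sym2 γ → Bool} {col : Bool} {e : Sym2 γ}
    (hemb : ∀ e ∈ G.edgeSet, Embeds G (G.deleteEdges {e}))
    (hc : ∀ e' ≠ e, c' e' = c e') (h : HasMonoCopy F c' col G) :
    HasMonoCopy (F.deleteEdges {e}) c col G := by
  obtain ⟨f, hf, hfG⟩ := h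
  suffices ∃ g : α → γ, Function.Injective g ∧
      ∀ ⦃x y⦄, G.Adj x y → (F.Adj (g x) (g y) ∧ c' s(g x, g y) = col) ∧ s(g x, g y) ≠ e by
    obtain ⟨g, hg, hgG⟩ := this
    refine ⟨g, hg, fun x y hxy => ?_⟩
    obtain ⟨⟨hF, hcol⟩, hne⟩ := hgG hxy
    exact ⟨by simpa [SimpleGraph.deleteEdges_adj] using ⟨hF, hne⟩, by rw [← hc _ hne, hcol]⟩
  by_cases hex : ∃ d ∈ G.edgeSet, d.map f = e
  · obtain ⟨d, hd, rfl⟩ := hex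
    obtain ⟨g, hg, hgG⟩ := hemb d hd
    refine ⟨f ∘ g, hf.comp hg, fun x y hxy => ?_⟩
    have hadj := hgG hxy
    rw [SimpleGraph.deleteEdges_adj] at hadj
    exact ⟨hfG hadj.1, fun h => hadj.2 (Sym2.map.injective hf h)⟩
  · exact ⟨f, hf, fun x y hxy => ⟨hfG hxy, fun h => hex ⟨s(x, y), hxy, h⟩⟩⟩

/-- The key step of Proposition 2: if `G` has an edge and embeds into `G - e` for every edge
`e` of `G`, and `F → (G,H)`, then `F - e → (G,H)` for every edge `e` of `F`; in particular,
if `F - e` has a `(G,H)`-good coloring for some edge `e` of `F`, then so does `F`. -/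
theorem stmt_6 {α : Type u} {β : Type v} {γ : Type w}
    (G : SimpleGraph α) (H : SimpleGraph β)
    (hne : G.edgeSet.Nonempty)
    (hemb : ∀ e ∈ G.edgeSet, Embeds G (G.deleteEdges {e}))
    (F : SimpleGraph γ) (hF : Arrows F G H) :
    (∀ e ∈ F.edgeSet, Arrows (F.deleteEdges {e}) G H) ∧
      ((∃ e ∈ F.edgeSet, ∃ c, GoodColoring (F.deleteEdges {e}) G H c) →
        ∃ c, GoodColoring F G H c) := by
  classical
  have key : ∀ e ∈ F.edgeSet, Arrows (F.deleteEdges {e}) G H := fun e _ c => by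
    rcases hF (Function.update c e true) with h | ⟨f, hf, hfH⟩
    · exact .inl (h.deleteEdge hemb fun e' he' => Function.update_of_ne he' _ _)
    · refine .inr ⟨f, hf, fun x y hxy => ?_⟩
      obtain ⟨hadj, hcol⟩ := hfH hxy
      have hne : s(f x, f y) ≠ e := by
        rintro rfl
        simp at hcol
      rw [Function.update_of_ne hne] at hcol
      exact ⟨by simpa [SimpleGraph.deleteEdges_adj] using ⟨hadj, hne⟩, hcol⟩
  exact ⟨key, fun ⟨e, he, c, hred, hblue⟩ => ((key e he c).elim hred hblue).elim⟩
end

section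
/- Let G and H be nontrivial (having at least one edge) connected graphs, let n be a positive integer, and suppose F_1, ..., F_n are graphs, each of which is (G,H)-minimal. Then the disjoint union F_1 ∪ ⋯ ∪ F_n is (G, nH)-minimal, where nH denotes the disjoint union of n copies of H. Consequently, if a (G,H)-minimal graph exists, then a (G,nH)-minimal graph exists. -/
open SimpleGraph

universe u v w x

/-- `f` is a copy of `G` in `F` all of whose edges get color `col` under `c`. -/
def IsMonoCopy {α β : Type*} (F : SimpleGraph α) (c : Sym2 α → Bool) (col : Bool)
    (G : SimpleGraph β) (f : β → α) : Prop :=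
  Function.Injective f ∧ ∀ ⦃x y⦄, G.Adj x y → F.Adj (f x) (f y) ∧ c s(f x, f y) = col

lemma IsMonoCopy.mono {α β : Type*} {F F' : SimpleGraph α} {c : Sym2 α → Bool} {col : Bool}
    {G : SimpleGraph β} {f : β → α} (hf : IsMonoCopy F c col G f) (h : F ≤ F') :
    IsMonoCopy F' c col G f :=
  ⟨hf.1, fun _ _ hxy => ⟨h (hf.2 hxy).1, (hf.2 hxy).2⟩⟩

section Sigma

variable {ι : Type*} {V : ι → Type*}

lemma sigmaGraph_adj_mk (G : ∀ i, SimpleGraph (V i)) (i : ι) (a b : V i) :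
    (sigmaGraph G).Adj ⟨i, a⟩ ⟨i, b⟩ ↔ (G i).Adj a b := by
  simp only [sigmaGraph, SimpleGraph.fromRel_adj]
  constructor
  · rintro ⟨-, ⟨_, h⟩ | ⟨_, h⟩⟩
    · exact h
    · exact h.symm
  · intro h
    refine ⟨fun e => h.ne ?_, Or.inl ⟨trivial, h⟩⟩
    simpa using e

lemma sigmaGraph_adj_fst {G : ∀ i, SimpleGraph (V i)} {p q : Σ i, V i}
    (h : (sigmaGraph G).Adj p q) : p.1 = q.1 := by
  simp only [sigmaGraph, SimpleGraph.fromRel_adj] at h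
  obtain ⟨-, ⟨h, _⟩ | ⟨h, _⟩⟩ := h
  · exact h
  · exact h.symm

/-- The coloring of a disjoint union obtained from colorings of its parts. -/
noncomputable def sigmaColoring (c : ∀ i, Sym2 (V i) → Bool) (e : Sym2 (Σ i, V i)) : Bool :=
  open Classical in decide (∃ i, ∃ e' : Sym2 (V i), Sym2.map (Sigma.mk i) e' = e ∧ c i e' = true)

lemma sigmaColoring_mk (c : ∀ i, Sym2 (V i) → Bool) (i : ι) (a b : V i) :
    sigmaColoring c s(⟨i, a⟩, ⟨i, b⟩) = c i s(a, b) := by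
  rw [Bool.eq_iff_iff]
  simp only [sigmaColoring, decide_eq_true_eq]
  constructor
  · rintro ⟨j, e', he, hc⟩
    obtain rfl : j = i := by
      have hm : (⟨i, a⟩ : Σ i, V i) ∈ Sym2.map (Sigma.mk j) e' := by
        rw [he]; exact Sym2.mem_mk_left _ _
      obtain ⟨v, -, hv⟩ := Sym2.mem_map.1 hm
      exact congrArg Sigma.fst hv
    have : e' = s(a, b) := Sym2.map.injective sigma_mk_injective (by rw [he, Sym2.map_mk])
    rwa [← this]
  · intro h
    exact ⟨i, s(a, b), by rw [Sym2.map_mk], h⟩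

/-- A map from a connected graph to a disjoint union which preserves adjacency has its image
inside one part. -/
lemma SimpleGraph.Connected.exists_sigma_factor {β : Type*} {H : SimpleGraph β}
    (hH : H.Connected) {f : β → Σ i, V i} (hf : ∀ ⦃x y⦄, H.Adj x y → (f x).1 = (f y).1) :
    ∃ (i : ι) (g : β → V i), ∀ x, f x = ⟨i, g x⟩ := by
  obtain ⟨x₀⟩ := hH.nonempty
  have key : ∀ x, (f x).1 = (f x₀).1 := by
    intro x
    obtain ⟨p⟩ := hH.preconnected x x₀
    induction p with
    | nil => rfl
    | cons h _ ih => exact (hf h).trans ih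
  have : ∀ x, ∃ v : V (f x₀).1, f x = ⟨(f x₀).1, v⟩ := by
    intro x
    have hx := key x
    generalize f x = p at hx ⊢
    obtain ⟨j, v⟩ := p
    obtain rfl : j = _ := hx
    exact ⟨v, rfl⟩
  choose g hg using this
  exact ⟨_, g, hg⟩

lemma IsMonoCopy.exists_sigma_factor {β : Type*} {H : SimpleGraph β} (hH : H.Connected)
    {K : ∀ i, SimpleGraph (V i)} {c : ∀ i, Sym2 (V i) → Bool} {col : Bool} {f : β → Σ i, V i}
    (hf : IsMonoCopy (sigmaGraph K) (sigmaColoring c) col H f) :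
    ∃ (i : ι) (g : β → V i), (∀ x, f x = ⟨i, g x⟩) ∧ IsMonoCopy (K i) (c i) col H g := by
  obtain ⟨i, g, hg⟩ :=
    hH.exists_sigma_factor (f := f) fun x y h => sigmaGraph_adj_fst (hf.2 h).1
  refine ⟨i, g, hg, fun x y h => hf.1 (by rw [hg, hg, h]), fun x y h => ?_⟩
  have := hf.2 h
  rwa [hg, hg, sigmaGraph_adj_mk, sigmaColoring_mk] at this

/-- The part of a subgraph of a disjoint union lying in the `i`-th summand. -/
def sigmaSubgraphPart {F : ∀ i, SimpleGraph (V i)} (F' : (sigmaGraph F).Subgraph) (i : ι) :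
    (F i).Subgraph where
  verts := {v | ⟨i, v⟩ ∈ F'.verts}
  Adj a b := F'.Adj ⟨i, a⟩ ⟨i, b⟩
  adj_sub h := (sigmaGraph_adj_mk F i _ _).1 (F'.adj_sub h)
  edge_vert h := F'.edge_vert h
  symm := ⟨fun _ _ h => h.symm⟩

lemma exists_sigmaSubgraphPart_ne_top {F : ∀ i, SimpleGraph (V i)}
    {F' : (sigmaGraph F).Subgraph} (h : F' ≠ ⊤) : ∃ i, sigmaSubgraphPart F' i ≠ ⊤ := by
  by_contra! H
  apply h
  ext p q
  · obtain ⟨i, v⟩ := p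
    have : v ∈ (sigmaSubgraphPart F' i).verts := by rw [H i]; trivial
    exact iff_of_true this trivial
  · refine ⟨fun h => F'.adj_sub h, fun h => ?_⟩
    obtain ⟨i, a⟩ := p
    obtain ⟨j, b⟩ := q
    obtain rfl : i = j := sigmaGraph_adj_fst h
    have : (sigmaSubgraphPart F' i).Adj a b := by
      rw [H i]; exact (sigmaGraph_adj_mk F i a b).1 h
    exact this

lemma spanningCoe_le_sigmaGraph {F : ∀ i, SimpleGraph (V i)} (F' : (sigmaGraph F).Subgraph) :
    F'.spanningCoe ≤ sigmaGraph fun i => (sigmaSubgraphPart F' i).spanningCoe := by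
  rintro ⟨i, a⟩ ⟨j, b⟩ h
  obtain rfl : i = j := sigmaGraph_adj_fst (F'.adj_sub h)
  exact (sigmaGraph_adj_mk _ i a b).2 h

lemma IsMonoCopy.sigma_of_coe {β : Type*} {K : SimpleGraph β} {F : ∀ i, SimpleGraph (V i)}
    {F' : (sigmaGraph F).Subgraph} {c : Sym2 (Σ i, V i) → Bool} {col : Bool} {f : β → F'.verts}
    (hf : IsMonoCopy F'.coe (fun e => c (Sym2.map Subtype.val e)) col K f) :
    IsMonoCopy (sigmaGraph fun i => (sigmaSubgraphPart F' i).spanningCoe) c col K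
      (fun v => (f v : Σ i, V i)) :=
  ⟨Subtype.val_injective.comp hf.1, fun _ _ h =>
    ⟨spanningCoe_le_sigmaGraph F' (hf.2 h).1, (hf.2 h).2⟩⟩

end Sigma

lemma SimpleGraph.Connected.exists_adj_of_edgeSet_nonempty {β : Type*} {G : SimpleGraph β}
    (hG : G.Connected) (he : G.edgeSet.Nonempty) (v : β) : ∃ w, G.Adj v w := by
  obtain ⟨e, he⟩ := he
  induction e with
  | h x y =>
    obtain ⟨p⟩ := hG.preconnected v x
    cases p with
    | nil => exact ⟨y, he⟩
    | cons h _ => exact ⟨_, h⟩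

lemma IsMonoCopy.hasMonoCopy_coe {α β : Type*} {F : SimpleGraph α} {F' : F.Subgraph}
    {c : Sym2 F'.verts → Bool} {c' : Sym2 α → Bool} {col : Bool} {G : SimpleGraph β}
    (hG : ∀ v, ∃ w, G.Adj v w) (hc : ∀ e, c' (Sym2.map Subtype.val e) = c e) {f : β → α}
    (hf : IsMonoCopy F'.spanningCoe c' col G f) : HasMonoCopy F'.coe c col G := by
  have hm : ∀ v, f v ∈ F'.verts := fun v =>
    let ⟨_, hw⟩ := hG v
    F'.edge_vert (hf.2 hw).1
  refine ⟨fun v => ⟨f v, hm v⟩, fun x y h => hf.1 (congrArg Subtype.val h), fun x y h => ?_⟩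
  refine ⟨(hf.2 h).1, ?_⟩
  rw [← hc, Sym2.map_mk]
  exact (hf.2 h).2

lemma exists_goodColoring_spanningCoe {α β γ : Type*} {F : SimpleGraph α} {F' : F.Subgraph}
    {G : SimpleGraph β} {H : SimpleGraph γ} (hG : ∀ v, ∃ w, G.Adj v w)
    (hH : ∀ v, ∃ w, H.Adj v w) (h : ¬ Arrows F'.coe G H) :
    ∃ c, GoodColoring F'.spanningCoe G H c := by
  rw [Arrows] at h
  push Not at h
  obtain ⟨c, hr, hb⟩ := h
  have hc : ∀ e, Function.extend (Sym2.map Subtype.val) c (fun _ => true)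
      (Sym2.map Subtype.val e) = c e :=
    (Sym2.map.injective Subtype.val_injective).extend_apply c _
  exact ⟨_, fun ⟨_, hf⟩ => hr (IsMonoCopy.hasMonoCopy_coe hG hc hf),
    fun ⟨_, hf⟩ => hb (IsMonoCopy.hasMonoCopy_coe hH hc hf)⟩

lemma HasMonoCopy.exists_adj {α β : Type*} {F : SimpleGraph α} {c : Sym2 α → Bool} {col : Bool}
    {G : SimpleGraph β} (h : HasMonoCopy F c col G) (hG : G.edgeSet.Nonempty) :
    ∃ x y, F.Adj x y := by
  obtain ⟨f, -, hf⟩ := h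
  obtain ⟨e, he⟩ := hG
  induction e with
  | h x y => exact ⟨_, _, (hf he).1⟩

/-- A minimal graph has a coloring without red copies of `G` in which all blue copies of `H`
share a vertex. -/
lemma IsRamseyMinimal.exists_coloring {α β γ : Type*} {F : SimpleGraph α}
    {G : SimpleGraph β} {H : SimpleGraph γ} (hF : IsRamseyMinimal F G H)
    (hGc : G.Connected) (hHc : H.Connected)
    (hGe : G.edgeSet.Nonempty) (hHe : H.edgeSet.Nonempty) :
    ∃ (c : Sym2 α → Bool) (x : α), ¬ HasMonoCopy F c true G ∧
      ∀ f, IsMonoCopy F c false H f → x ∈ Set.range f := by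
  classical
  obtain ⟨x, y, hxy⟩ : ∃ x y, F.Adj x y :=
    (hF.1 fun _ => true).elim (·.exists_adj hGe) (·.exists_adj hHe)
  let F' : F.Subgraph := (⊤ : F.Subgraph).deleteEdges {s(x, y)}
  have hF' : F' ≠ ⊤ := by
    intro h
    have : F'.Adj x y := by rw [h]; exact hxy
    simp [F'] at this
  have hadj : ∀ {a b}, F.Adj a b → s(a, b) ≠ s(x, y) → F'.spanningCoe.Adj a b := by
    intro a b h hne
    rw [SimpleGraph.Subgraph.spanningCoe_adj, SimpleGraph.Subgraph.deleteEdges_adj]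
    exact ⟨h, hne⟩
  obtain ⟨c, hr, hb⟩ := exists_goodColoring_spanningCoe
    (hGc.exists_adj_of_edgeSet_nonempty hGe) (hHc.exists_adj_of_edgeSet_nonempty hHe)
    (hF.2 F' hF')
  refine ⟨Function.update c s(x, y) false, x, ?_, ?_⟩
  · rintro ⟨f, hinj, hf⟩
    refine hr ⟨f, hinj, fun a b hab => ?_⟩
    obtain ⟨h₁, h₂⟩ := hf hab
    have hne : s(f a, f b) ≠ s(x, y) := by
      intro h
      simp [h] at h₂
    rw [Function.update_of_ne hne] at h₂
    exact ⟨hadj h₁ hne, h₂⟩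
  · rintro f ⟨hinj, hf⟩
    by_contra hx
    refine hb ⟨f, hinj, fun a b hab => ?_⟩
    obtain ⟨h₁, h₂⟩ := hf hab
    have hne : s(f a, f b) ≠ s(x, y) := by
      intro h
      have : x ∈ s(f a, f b) := h ▸ Sym2.mem_mk_left x y
      obtain rfl | rfl := Sym2.mem_iff.1 this
      · exact hx ⟨a, rfl⟩
      · exact hx ⟨b, rfl⟩
    rw [Function.update_of_ne hne] at h₂
    exact ⟨hadj h₁ hne, h₂⟩

lemma arrows_sigmaGraph {ι α β : Type*} {G : SimpleGraph α} {H : SimpleGraph β}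
    {γ : ι → Type*} {F : ∀ i, SimpleGraph (γ i)} (hF : ∀ i, Arrows (F i) G H) :
    Arrows (sigmaGraph F) G (sigmaGraph fun _ : ι => H) := by
  intro c
  by_cases hr : HasMonoCopy (sigmaGraph F) c true G
  · exact Or.inl hr
  right
  have hb : ∀ i, HasMonoCopy (F i) (fun e => c (Sym2.map (Sigma.mk i) e)) false H := by
    refine fun i => (hF i _).resolve_left fun ⟨f, hinj, hf⟩ => hr ⟨fun x => ⟨i, f x⟩,
      fun x y h => hinj (sigma_mk_injective h), fun x y h => ?_⟩
    rw [sigmaGraph_adj_mk]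
    exact hf h
  choose f hinj hf using hb
  refine ⟨fun p => ⟨p.1, f p.1 p.2⟩, ?_, ?_⟩
  · rintro ⟨i, a⟩ ⟨j, b⟩ h
    obtain rfl : i = j := congrArg Sigma.fst h
    obtain rfl : a = b := hinj i (sigma_mk_injective h)
    rfl
  · rintro ⟨i, a⟩ ⟨j, b⟩ h
    obtain rfl : i = j := sigmaGraph_adj_fst h
    rw [sigmaGraph_adj_mk] at h ⊢
    exact hf i h

lemma IsRamseyMinimal.sigmaGraph {ι α β : Type*} [Finite ι] {G : SimpleGraph α}
    {H : SimpleGraph β} (hGc : G.Connected) (hHc : H.Connected)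
    (hGe : G.edgeSet.Nonempty) (hHe : H.edgeSet.Nonempty)
    {γ : ι → Type*} {F : ∀ i, SimpleGraph (γ i)} (hF : ∀ i, IsRamseyMinimal (F i) G H) :
    IsRamseyMinimal (sigmaGraph F) G (sigmaGraph fun _ : ι => H) := by
  classical
  refine ⟨arrows_sigmaGraph fun i => (hF i).1, fun F' hF' harr => ?_⟩
  obtain ⟨i, hi⟩ := exists_sigmaSubgraphPart_ne_top hF'
  obtain ⟨ci, hri, hbi⟩ := exists_goodColoring_spanningCoe
    (hGc.exists_adj_of_edgeSet_nonempty hGe) (hHc.exists_adj_of_edgeSet_nonempty hHe)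
    ((hF i).2 _ hi)
  have hcol : ∀ j, ∃ c : Sym2 (γ j) → Bool,
      ¬ HasMonoCopy (sigmaSubgraphPart F' j).spanningCoe c true G ∧
      ∃ x, ∀ f, IsMonoCopy (sigmaSubgraphPart F' j).spanningCoe c false H f →
        j ≠ i ∧ x ∈ Set.range f := by
    intro j
    obtain ⟨c, x, hr, hb⟩ := (hF j).exists_coloring hGc hHc hGe hHe
    by_cases hj : j = i
    · subst hj
      exact ⟨ci, hri, x, fun f hf => (hbi ⟨f, hf⟩).elim⟩
    · exact ⟨c, fun ⟨f, hf⟩ => hr ⟨f, IsMonoCopy.mono hf (SimpleGraph.Subgraph.spanningCoe_le _)⟩,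
        x, fun f hf => ⟨hj, hb f (hf.mono (SimpleGraph.Subgraph.spanningCoe_le _))⟩⟩
  choose c hr x hb using hcol
  obtain ⟨f, hf⟩ | ⟨f, hf⟩ := harr fun e => sigmaColoring c (Sym2.map Subtype.val e)
  · obtain ⟨j, g, -, hg⟩ := IsMonoCopy.exists_sigma_factor hGc (IsMonoCopy.sigma_of_coe hf)
    exact hr j ⟨g, hg⟩
  · have hf := IsMonoCopy.sigma_of_coe hf
    have hpart : ∀ k : ι, IsMonoCopy
        (_root_.sigmaGraph fun i => (sigmaSubgraphPart F' i).spanningCoe)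
        (sigmaColoring c) false H (fun v => (f ⟨k, v⟩ : Σ i, γ i)) := fun k =>
      ⟨fun a b h => sigma_mk_injective (hf.1 h),
        fun a b h => hf.2 ((sigmaGraph_adj_mk (fun _ : ι => H) k a b).2 h)⟩
    choose φ g hg hmono using fun k => (hpart k).exists_sigma_factor hHc
    have hφ : Function.Injective φ := by
      intro k l hkl
      obtain ⟨a, ha⟩ := (hb _ _ (hmono k)).2
      obtain ⟨b, hb⟩ := (hb _ _ (hmono l)).2
      have hfa := hg k a
      have hfb := hg l b
      rw [ha] at hfa
      rw [hb, ← hkl] at hfb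
      exact congrArg Sigma.fst (hf.1 (hfa.trans hfb.symm))
    obtain ⟨k, hk⟩ := Finite.surjective_of_injective hφ i
    exact (hb _ _ (hmono k)).1 hk

/-- Proposition 4: for nontrivial connected `G` and `H`, if each `F i` is `(G,H)`-minimal then
`⋃ᵢ F i` is `(G, nH)`-minimal; consequently, if a `(G,H)`-minimal graph exists then a
`(G,nH)`-minimal graph exists. -/
theorem stmt_8 {α : Type u} {β : Type v} (G : SimpleGraph α) (H : SimpleGraph β)
    (hGc : G.Connected) (hHc : H.Connected)
    (hGe : G.edgeSet.Nonempty) (hHe : H.edgeSet.Nonempty)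
    (n : ℕ) (hn : 0 < n)
    {γ : Fin n → Type w} (F : ∀ i, SimpleGraph (γ i))
    (hF : ∀ i, IsRamseyMinimal (F i) G H) :
    IsRamseyMinimal (sigmaGraph F) G (sigmaGraph fun _ : Fin n => H) ∧
      ((∃ (δ : Type x) (F' : SimpleGraph δ), IsRamseyMinimal F' G H) →
        ∃ (δ : Type x) (F'' : SimpleGraph δ),
          IsRamseyMinimal F'' G (sigmaGraph fun _ : Fin n => H)) := by
  exact ⟨IsRamseyMinimal.sigmaGraph hGc hHc hGe hHe hF, fun ⟨_, F', hF'⟩ =>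
    ⟨_, sigmaGraph fun _ : Fin n => F',
      IsRamseyMinimal.sigmaGraph hGc hHc hGe hHe fun _ => hF'⟩⟩
end

section
/- Let G, H_1, and H_2 be graphs, and let F be a (G,H_1)-minimal graph. If for every subgraph Ĥ_1 of F isomorphic to H_1 it holds that F − V(Ĥ_1) → (G,H_2), then F is (G, H_1 ∪ H_2)-minimal, where H_1 ∪ H_2 denotes the disjoint union of H_1 and H_2. -/
open SimpleGraph

universe u v w x

theorem sumGraph_adj_inl {α β : Type*} {G : SimpleGraph α} {H : SimpleGraph β} {x y : α} :
    (sumGraph G H).Adj (Sum.inl x) (Sum.inl y) ↔ G.Adj x y := by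
  simp only [sumGraph, SimpleGraph.fromRel_adj, G.adj_comm y x, or_self, ne_eq, Sum.inl.injEq]
  exact ⟨And.right, fun h => ⟨h.ne, h⟩⟩

theorem sumGraph_adj_inr {α β : Type*} {G : SimpleGraph α} {H : SimpleGraph β} {x y : β} :
    (sumGraph G H).Adj (Sum.inr x) (Sum.inr y) ↔ H.Adj x y := by
  simp only [sumGraph, SimpleGraph.fromRel_adj, H.adj_comm y x, or_self, ne_eq, Sum.inr.injEq]
  exact ⟨And.right, fun h => ⟨h.ne, h⟩⟩

theorem not_sumGraph_adj_inl_inr {α β : Type*} {G : SimpleGraph α} {H : SimpleGraph β}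
    {x : α} {y : β} : ¬ (sumGraph G H).Adj (Sum.inl x) (Sum.inr y) := by
  simp [sumGraph]

/-- A monochromatic copy of a disjoint union contains one of its left part. -/
theorem HasMonoCopy.of_sumGraph_left {α β₁ β₂ : Type*} {F : SimpleGraph α} {c : Sym2 α → Bool}
    {col : Bool} {H₁ : SimpleGraph β₁} {H₂ : SimpleGraph β₂}
    (h : HasMonoCopy F c col (sumGraph H₁ H₂)) : HasMonoCopy F c col H₁ := by
  obtain ⟨f, hf, hadj⟩ := h
  exact ⟨f ∘ Sum.inl, hf.comp Sum.inl_injective, fun _ _ hxy => hadj (sumGraph_adj_inl.2 hxy)⟩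

/-- A monochromatic copy in an induced subgraph is one in the whole graph avoiding the
removed vertices. -/
theorem HasMonoCopy.exists_of_induce {α β : Type*} {F : SimpleGraph α} {c : Sym2 α → Bool}
    {col : Bool} {H : SimpleGraph β} {s : Set α}
    (h : HasMonoCopy (F.induce s) (c ∘ Sym2.map Subtype.val) col H) :
    ∃ f : β → α, Function.Injective f ∧ (∀ x, f x ∈ s) ∧
      ∀ ⦃x y⦄, H.Adj x y → F.Adj (f x) (f y) ∧ c s(f x, f y) = col := by
  obtain ⟨f, hf, hadj⟩ := h
  exact ⟨Subtype.val ∘ f, Subtype.val_injective.comp hf, fun x => (f x).2,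
    fun _ _ hxy => hadj hxy⟩

/-- Proposition 5: if `F` is `(G,H₁)`-minimal and `F - V(Ĥ₁) → (G,H₂)` for every copy `Ĥ₁`
of `H₁` in `F`, then `F` is `(G, H₁ ∪ H₂)`-minimal. -/
theorem stmt_9 {α : Type u} {β₁ : Type v} {β₂ : Type w} {γ : Type x}
    (G : SimpleGraph α) (H₁ : SimpleGraph β₁) (H₂ : SimpleGraph β₂) (F : SimpleGraph γ)
    (hF : IsRamseyMinimal F G H₁)
    (h : ∀ f : β₁ → γ, Function.Injective f →
      (∀ ⦃x y⦄, H₁.Adj x y → F.Adj (f x) (f y)) →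
      Arrows (F.induce (Set.range f)ᶜ) G H₂) :
    IsRamseyMinimal F G (sumGraph H₁ H₂) := by
  refine ⟨fun c => ?_, fun F' hF' hA => hF.2 F' hF' fun c =>
    (hA c).imp_right HasMonoCopy.of_sumGraph_left⟩
  rcases hF.1 c with hG | ⟨f, hf, hfadj⟩
  · exact Or.inl hG
  rcases h f hf (fun _ _ hxy => (hfadj hxy).1) (c ∘ Sym2.map Subtype.val) with hG | hH
  · obtain ⟨g, hg, -, hgadj⟩ := hG.exists_of_induce
    exact Or.inl ⟨g, hg, hgadj⟩
  · obtain ⟨g, hg, hgs, hgadj⟩ := hH.exists_of_induce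
    refine Or.inr ⟨Sum.elim f g, hf.sumElim hg fun a b hab => hgs b ⟨a, hab⟩, ?_⟩
    rintro (x | x) (y | y) hxy
    · exact hfadj (sumGraph_adj_inl.1 hxy)
    · exact absurd hxy not_sumGraph_adj_inl_inr
    · exact absurd hxy.symm not_sumGraph_adj_inl_inr
    · exact hgadj (sumGraph_adj_inr.1 hxy)
end

section
/- The disjoint union of two copies of the double ray ℤ is (2S_1, ℤ ∪ ℕ)-minimal, where 2S_1 is the disjoint union of two single edges (a matching of size two), ℤ is the double ray, and ℕ is the ray. -/
open SimpleGraph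

universe u v w x

section AdjacencyLemmas

variable {α β : Type*} (G : SimpleGraph α) (H : SimpleGraph β)

@[simp] lemma sumGraph_adj_inl_inl (a b : α) :
    (sumGraph G H).Adj (Sum.inl a) (Sum.inl b) ↔ G.Adj a b := by
  simp only [sumGraph, fromRel_adj, ne_eq, Sum.inl.injEq, G.adj_comm b a, or_self]
  exact ⟨fun h => h.2, fun h => ⟨h.ne, h⟩⟩

@[simp] lemma sumGraph_adj_inr_inr (a b : β) :
    (sumGraph G H).Adj (Sum.inr a) (Sum.inr b) ↔ H.Adj a b := by
  simp only [sumGraph, fromRel_adj, ne_eq, Sum.inr.injEq, H.adj_comm b a, or_self]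
  exact ⟨fun h => h.2, fun h => ⟨h.ne, h⟩⟩

@[simp] lemma sumGraph_adj_inl_inr (a : α) (b : β) :
    ¬ (sumGraph G H).Adj (Sum.inl a) (Sum.inr b) := by
  simp [sumGraph]

@[simp] lemma sumGraph_adj_inr_inl (a : α) (b : β) :
    ¬ (sumGraph G H).Adj (Sum.inr b) (Sum.inl a) := by
  simp [sumGraph]

end AdjacencyLemmas

@[simp] lemma doubleRay_adj (a b : ℤ) : doubleRay.Adj a b ↔ b = a + 1 ∨ a = b + 1 := by
  simp only [doubleRay, fromRel_adj]
  omega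

@[simp] lemma rayGraph_adj (a b : ℕ) : rayGraph.Adj a b ↔ b = a + 1 ∨ a = b + 1 := by
  simp only [rayGraph, fromRel_adj]
  omega

/-- Two disjoint edges of color `col` form a monochromatic copy of `2S₁`. -/
lemma hasMonoCopy_twoS1 {α : Type*} {F : SimpleGraph α} {c : Sym2 α → Bool} {col : Bool}
    {p q r s : α} (hpq : F.Adj p q) (hrs : F.Adj r s) (hcpq : c s(p, q) = col)
    (hcrs : c s(r, s) = col) (hpr : p ≠ r) (hps : p ≠ s) (hqr : q ≠ r) (hqs : q ≠ s) :
    HasMonoCopy F c col twoS1 := by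
  refine ⟨Sum.elim ![p, q] ![r, s], ?_, ?_⟩
  · have h₁ := hpq.ne
    have h₂ := hrs.ne
    rintro (x | x) (y | y) <;> fin_cases x <;> fin_cases y <;> simp_all [eq_comm]
  · have hcqp : c s(q, p) = col := by rwa [Sym2.eq_swap]
    have hcsr : c s(s, r) = col := by rwa [Sym2.eq_swap]
    rintro (x | x) (y | y) <;> fin_cases x <;> fin_cases y <;>
      simp [twoS1, hpq, hrs, hpq.symm, hrs.symm, hcpq, hcrs, hcqp, hcsr]

/-- A coloring of two disjoint double rays `i` and `j` in `F` in which `i` is all blue yields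
a red `2S₁` or a blue `ℤ ∪ ℕ`. -/
lemma hasMonoCopy_or_of_blue_doubleRay {α : Type*} {F : SimpleGraph α} {c : Sym2 α → Bool}
    {i j : ℤ → α} (hi : i.Injective) (hj : j.Injective) (hij : ∀ a b, i a ≠ j b)
    (hFi : ∀ a, F.Adj (i a) (i (a + 1))) (hFj : ∀ a, F.Adj (j a) (j (a + 1)))
    (hc : ∀ a, c s(i a, i (a + 1)) = false) :
    HasMonoCopy F c true twoS1 ∨ HasMonoCopy F c false (sumGraph doubleRay rayGraph) := by
  refine or_iff_not_imp_left.2 fun hred => ?_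
  obtain ⟨a, ha⟩ : ∃ a : ℤ, ∀ n : ℕ, c s(j (a + n), j (a + n + 1)) = false := by
    by_cases h : ∃ a, c s(j a, j (a + 1)) = true
    · obtain ⟨a, ha⟩ := h
      refine ⟨a + 2, fun n => ?_⟩
      by_contra hn
      refine hred (hasMonoCopy_twoS1 (hFj a) (hFj (a + 2 + n)) ha (by simpa using hn) ?_ ?_ ?_ ?_)
        <;> refine hj.ne ?_ <;> omega
    · exact ⟨0, fun n => by simpa using fun hb => h ⟨_, hb⟩⟩
  refine ⟨Sum.elim i fun n => j (a + n), ?_, ?_⟩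
  · refine hi.sumElim (fun m n h => ?_) fun m n => hij _ _
    have := hj h
    omega
  · rintro (x | x) (y | y) h <;> simp at h
    · rcases h with rfl | rfl
      · exact ⟨hFi _, hc _⟩
      · exact ⟨(hFi _).symm, by simpa [Sym2.eq_swap] using hc y⟩
    · rcases h with rfl | rfl
      · have h₁ := hFj (a + x)
        have h₂ := ha x
        rw [add_assoc] at h₁ h₂
        exact ⟨by simpa using h₁, by simpa using h₂⟩
      · have h₁ := (hFj (a + y)).symm
        have h₂ := ha y
        rw [Sym2.eq_swap] at h₂
        rw [add_assoc] at h₁ h₂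
        exact ⟨by simpa using h₁, by simpa using h₂⟩

lemma arrows_two_doubleRays :
    Arrows (sumGraph doubleRay doubleRay) twoS1 (sumGraph doubleRay rayGraph) := by
  intro c
  by_cases hl : ∀ a : ℤ, c s(Sum.inl a, Sum.inl (a + 1)) = false
  · exact hasMonoCopy_or_of_blue_doubleRay Sum.inl_injective Sum.inr_injective
      (by simp) (by simp) (by simp) hl
  by_cases hr : ∀ a : ℤ, c s(Sum.inr a, Sum.inr (a + 1)) = false
  · exact hasMonoCopy_or_of_blue_doubleRay Sum.inr_injective Sum.inl_injective
      (by simp) (by simp) (by simp) hr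
  push Not at hl hr
  obtain ⟨a, ha⟩ := hl
  obtain ⟨b, hb⟩ := hr
  refine Or.inl (hasMonoCopy_twoS1 (p := Sum.inl a) (q := Sum.inl (a + 1)) (r := Sum.inr b)
    (s := Sum.inr (b + 1)) ?_ ?_ ?_ ?_ ?_ ?_ ?_ ?_) <;> simp [ha, hb]

/-- An injective two-way infinite walk in the double ray traverses every edge. -/
lemma exists_edge_eq_of_injective {h : ℤ → ℤ} (hinj : h.Injective)
    (hadj : ∀ n, doubleRay.Adj (h n) (h (n + 1))) (x : ℤ) :
    ∃ n, s(h n, h (n + 1)) = s(x, x + 1) := by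
  simp only [doubleRay_adj] at hadj
  have hstep : ∀ n, h (n + 1 + 1) - h (n + 1) = h (n + 1) - h n := fun n => by
    have h₁ := hadj n
    have h₂ := hadj (n + 1)
    have h₃ : h (n + 1 + 1) ≠ h n := hinj.ne (by omega)
    omega
  have hdiff : ∀ n, h (n + 1) - h n = h 1 - h 0 := fun n => by
    induction n using Int.induction_on with
    | zero => simp
    | succ k ih => rw [hstep, ih]
    | pred k ih =>
      rw [← ih, ← hstep]
      simp
  have hlin : ∀ n, h n = h 0 + n * (h 1 - h 0) := fun n => by
    induction n using Int.induction_on with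
    | zero => simp
    | succ k ih => linarith [hdiff k]
    | pred k ih =>
      have := hdiff (-k - 1)
      rw [sub_add_cancel] at this
      linarith
  have h01 := hadj 0
  rw [zero_add] at h01
  rcases h01 with h01 | h01
  · refine ⟨x - h 0, ?_⟩
    have h₁ : h (x - h 0) = x := by rw [hlin, h01]; ring
    have h₂ : h (x - h 0 + 1) = x + 1 := by rw [hlin, h01]; ring
    rw [h₁, h₂]
  · refine ⟨h 0 - x - 1, ?_⟩
    have h₁ : h (h 0 - x - 1) = x + 1 := by rw [hlin, h01]; ring
    have h₂ : h (h 0 - x - 1 + 1) = x := by rw [hlin, h01]; ring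
    rw [h₁, h₂, Sym2.eq_swap]

/-- An injective two-way infinite walk in two disjoint double rays traverses every edge of one
of them. -/
lemma exists_edge_eq_of_injective_sum {g : ℤ → ℤ ⊕ ℤ} (hinj : g.Injective)
    (hadj : ∀ n, (sumGraph doubleRay doubleRay).Adj (g n) (g (n + 1))) :
    (∀ x, ∃ n, s(g n, g (n + 1)) = s(Sum.inl x, Sum.inl (x + 1))) ∨
      ∀ x, ∃ n, s(g n, g (n + 1)) = s(Sum.inr x, Sum.inr (x + 1)) := by
  have hside : ∀ n, (g (n + 1)).isLeft = (g n).isLeft := fun n => by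
    have := hadj n
    rcases hx : g n with a | a <;> rcases hy : g (n + 1) with b | b <;> simp_all
  have hconst : ∀ n, (g n).isLeft = (g 0).isLeft := fun n => by
    induction n using Int.induction_on with
    | zero => rfl
    | succ k ih => rw [hside, ih]
    | pred k ih => rw [← ih, ← hside, sub_add_cancel]
  rcases h0 : (g 0).isLeft with _ | _
  · right
    have hg : ∀ n, ∃ a, g n = Sum.inr a := fun n =>
      Sum.isRight_iff.1 (by simp [← Sum.not_isLeft, hconst n, h0])
    choose h hh using hg
    simp only [hh, sumGraph_adj_inr_inr] at hadj
    intro x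
    obtain ⟨n, hn⟩ := exists_edge_eq_of_injective
      (fun m n hmn => hinj (by rw [hh, hh, hmn])) hadj x
    refine ⟨n, ?_⟩
    rw [hh, hh]
    exact congrArg (Sym2.map Sum.inr) hn
  · left
    have hg : ∀ n, ∃ a, g n = Sum.inl a := fun n =>
      Sum.isLeft_iff.1 (by rw [hconst, h0])
    choose h hh using hg
    simp only [hh, sumGraph_adj_inl_inl] at hadj
    intro x
    obtain ⟨n, hn⟩ := exists_edge_eq_of_injective
      (fun m n hmn => hinj (by rw [hh, hh, hmn])) hadj x
    refine ⟨n, ?_⟩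
    rw [hh, hh]
    exact congrArg (Sym2.map Sum.inl) hn

/-- A proper subgraph of two disjoint double rays misses an edge of one of them. -/
lemma exists_not_adj_of_ne_top {F : (sumGraph doubleRay doubleRay).Subgraph} (hF : F ≠ ⊤) :
    (∃ a, ¬ F.Adj (Sum.inl a) (Sum.inl (a + 1))) ∨
      ∃ a, ¬ F.Adj (Sum.inr a) (Sum.inr (a + 1)) := by
  by_contra! h
  obtain ⟨hl, hr⟩ := h
  refine hF (Subgraph.ext ?_ ?_)
  · refine Set.eq_univ_of_forall ?_
    rintro (a | a)
    · exact (hl a).fst_mem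
    · exact (hr a).fst_mem
  · ext x y
    refine ⟨fun h => h.adj_sub, fun h => ?_⟩
    rw [Subgraph.top_adj] at h
    rcases x with x | x <;> rcases y with y | y <;> simp at h
    · rcases h with rfl | rfl
      exacts [hl _, (hl _).symm]
    · rcases h with rfl | rfl
      exacts [hr _, (hr _).symm]

/-- If only the edge `e` is red, there is no red `2S₁`. -/
lemma not_hasMonoCopy_twoS1 {α : Type*} {F : SimpleGraph α} {c : Sym2 α → Bool} {col : Bool}
    {e : Sym2 α} (hc : ∀ d, c d = col → d = e) : ¬ HasMonoCopy F c col twoS1 := by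
  rintro ⟨f, hf, h⟩
  have h₁ := hc _ (h (x := Sum.inl 0) (y := Sum.inl 1) (by simp [twoS1])).2
  have h₂ := hc _ (h (x := Sum.inr 0) (y := Sum.inr 1) (by simp [twoS1])).2
  have h₃ := h₁.trans h₂.symm
  simp [hf.eq_iff] at h₃

/-- A subgraph of two disjoint double rays which, after removing the edge `e`, contains neither
double ray completely does not arrow `(2S₁, ℤ ∪ ℕ)`. -/
lemma not_arrows_of_forall {F : (sumGraph doubleRay doubleRay).Subgraph} {e : Sym2 (ℤ ⊕ ℤ)}
    (hl : ∃ x, s(Sum.inl x, Sum.inl (x + 1)) ∈ F.edgeSet → s(Sum.inl x, Sum.inl (x + 1)) = e)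
    (hr : ∃ x, s(Sum.inr x, Sum.inr (x + 1)) ∈ F.edgeSet → s(Sum.inr x, Sum.inr (x + 1)) = e) :
    ¬ Arrows F.coe twoS1 (sumGraph doubleRay rayGraph) := by
  classical
  intro h
  rcases h fun d => decide (d.map Subtype.val = e) with h | ⟨f, hf, h⟩
  · by_cases hd : ∃ d : Sym2 F.verts, d.map Subtype.val = e
    · obtain ⟨d, rfl⟩ := hd
      refine not_hasMonoCopy_twoS1 (e := d) (fun b hb => ?_) h
      exact Sym2.map.injective Subtype.val_injective (by simpa using hb)
    · obtain ⟨f, -, h⟩ := h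
      have := (h (x := Sum.inl 0) (y := Sum.inl 1) (by simp [twoS1])).2
      exact hd ⟨_, of_decide_eq_true this⟩
  · have hadj : ∀ n : ℤ, F.Adj (f (Sum.inl n)) (f (Sum.inl (n + 1))) ∧
        s((f (Sum.inl n) : ℤ ⊕ ℤ), (f (Sum.inl (n + 1)) : ℤ ⊕ ℤ)) ≠ e := fun n => by
      have hn := h (x := Sum.inl n) (y := Sum.inl (n + 1)) (by simp)
      exact ⟨hn.1, of_decide_eq_false hn.2⟩
    rcases exists_edge_eq_of_injective_sum
      (g := fun n => (f (Sum.inl n) : ℤ ⊕ ℤ))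
      (Subtype.val_injective.comp (hf.comp Sum.inl_injective))
      (fun n => (hadj n).1.adj_sub) with hg | hg
    · obtain ⟨x, hx⟩ := hl
      obtain ⟨n, hn⟩ := hg x
      have := hadj n
      rw [← Subgraph.mem_edgeSet, hn] at this
      exact this.2 (hx this.1)
    · obtain ⟨x, hx⟩ := hr
      obtain ⟨n, hn⟩ := hg x
      have := hadj n
      rw [← Subgraph.mem_edgeSet, hn] at this
      exact this.2 (hx this.1)

/-- Example 1: `2ℤ` is `(2S₁, ℤ ∪ ℕ)`-minimal. -/
theorem stmt_10 :
    IsRamseyMinimal (sumGraph doubleRay doubleRay) twoS1 (sumGraph doubleRay rayGraph) := by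
  refine ⟨arrows_two_doubleRays, fun F hF => ?_⟩
  rcases exists_not_adj_of_ne_top hF with ⟨a, ha⟩ | ⟨a, ha⟩
  · exact not_arrows_of_forall (e := s(Sum.inr 0, Sum.inr (0 + 1)))
      ⟨a, fun h => absurd h ha⟩ ⟨0, fun _ => rfl⟩
  · exact not_arrows_of_forall (e := s(Sum.inl 0, Sum.inl (0 + 1)))
      ⟨0, fun _ => rfl⟩ ⟨a, fun h => absurd h ha⟩
end
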